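/- arXiv:2007.12394 — 3 statements merged into one kernel-verified Lean document; each statement's English description precedes it below -/
import Mathlib

section
/- Let k be a perfect field of characteristic p > 0 and let (R, I) be a standard graded pair over k such that R is a two-dimensional domain, with graded maximal ideal 𝔪. Then the F-threshold c^I(𝔪) exists and c^I(𝔪) = α(R, I), the maximum support of the Hilbert–Kunz density function of (R, I). -/
/-!
STATEMENT 1: For a standard graded pair `(R, I)` over a perfect field of characteristic
`p > 0`, with `R` a two-dimensional domain and graded maximal ideal `𝔪`, the `F`-threshold
`c^I(𝔪)` exists and equals `α(R, I)`, the maximum support of the Hilbert–Kunz density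
function of `(R, I)`.
-/

open Filter Topology

/-- The Frobenius power `I^{[q]}` of an ideal `I`. -/
def Ideal.frobPow {R : Type*} [CommRing R] (I : Ideal R) (q : ℕ) : Ideal R :=
  Ideal.span ((fun f => f ^ q) '' (I : Set R))

/-- `ν_I(J, q) = min { r ∈ ℕ | J^{r+1} ⊆ I^{[q]} }`. -/
noncomputable def nuF {R : Type*} [CommRing R] (J I : Ideal R) (q : ℕ) : ℕ :=
  sInf {r : ℕ | J ^ (r + 1) ≤ I.frobPow q}

/-- The graded maximal (irrelevant) ideal `𝔪 = ⊕_{m>0} R_m` of an `ℕ`-graded algebra. -/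
def irrelevantIdeal {k R : Type*} [CommSemiring k] [CommRing R] [Algebra k R]
    (𝒜 : ℕ → Submodule k R) : Ideal R :=
  Ideal.span (⋃ n ∈ Set.Ioi (0 : ℕ), (𝒜 n : Set R))

/-- `dim_k (R/J)_m`: the `k`-dimension of the degree-`m` graded piece of `R/J`,
computed as `dim_k (𝒜 m / (J ∩ 𝒜 m))`. -/
noncomputable def gradedPieceDim {k R : Type*} [Field k] [CommRing R] [Algebra k R]
    (𝒜 : ℕ → Submodule k R) (J : Ideal R) (m : ℕ) : ℕ :=
  Module.finrank k ((𝒜 m) ⧸ (Submodule.comap (𝒜 m).subtype (J.restrictScalars k)))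

set_option linter.unusedSectionVars false
namespace FThr

open GradedRing

section
variable {k R : Type*} [Field k] [CommRing R] [Algebra k R]
    (𝒜 : ℕ → Submodule k R) [GradedAlgebra 𝒜]

lemma proj_mem (m : ℕ) (x : R) : proj 𝒜 m x ∈ 𝒜 m := by
  rw [proj_apply]; exact SetLike.coe_mem _

lemma proj_self {m : ℕ} {x : R} (hx : x ∈ 𝒜 m) : proj 𝒜 m x = x := by
  rw [proj_apply]; exact DirectSum.decompose_of_mem_same 𝒜 hx

lemma proj_ne {m n : ℕ} {x : R} (hx : x ∈ 𝒜 m) (h : m ≠ n) : proj 𝒜 n x = 0 := by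
  rw [proj_apply]; exact DirectSum.decompose_of_mem_ne 𝒜 hx h

lemma proj_mul_of_le {m d : ℕ} {a b : R} (hb : b ∈ 𝒜 d) (h : d ≤ m) :
    proj 𝒜 m (a * b) = proj 𝒜 (m - d) a * b := by
  simp only [proj_apply]; exact DirectSum.coe_decompose_mul_of_right_mem_of_le 𝒜 hb h

lemma proj_mul_of_not_le {m d : ℕ} {a b : R} (hb : b ∈ 𝒜 d) (h : ¬ d ≤ m) :
    proj 𝒜 m (a * b) = 0 := by
  simp only [proj_apply]; exact DirectSum.coe_decompose_mul_of_right_mem_of_not_le 𝒜 hb h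

lemma sum_proj (x : R) : ∃ s : Finset ℕ, ∑ i ∈ s, proj 𝒜 i x = x := by
  classical
  exact ⟨_, DirectSum.sum_support_decompose 𝒜 x⟩

lemma proj_mem_of_span {G : Set R} {T : Ideal R} {m : ℕ}
    (h : ∀ g ∈ G, ∃ d, g ∈ 𝒜 d ∧ ∀ r, d ≤ m → r ∈ 𝒜 (m - d) → r * g ∈ T)
    {w : R} (hw : w ∈ Ideal.span G) : proj 𝒜 m w ∈ T := by
  suffices H : ∀ r, proj 𝒜 m (r * w) ∈ T by simpa using H 1
  induction hw using Submodule.span_induction with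
  | mem g hg =>
    intro r
    obtain ⟨d, hd, h⟩ := h g hg
    by_cases hdm : d ≤ m
    · rw [proj_mul_of_le 𝒜 hd hdm]
      exact h _ hdm (proj_mem 𝒜 _ _)
    · rw [proj_mul_of_not_le 𝒜 hd hdm]; exact T.zero_mem
  | zero => intro r; simp
  | add x y _ _ hx hy => intro r; rw [mul_add, map_add]; exact T.add_mem (hx r) (hy r)
  | smul a x _ hx => intro r; rw [smul_eq_mul, ← mul_assoc]; exact hx _

lemma piece_fg (h0 : 𝒜 0 = Submodule.span k {1})
    (hstd : ∀ n, 𝒜 (n + 1) = 𝒜 1 * 𝒜 n)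
    (hfg : FiniteDimensional k (𝒜 1)) (m : ℕ) : (𝒜 m).FG := by
  induction m with
  | zero => rw [h0]; exact Submodule.fg_span_singleton 1
  | succ n ih =>
    rw [hstd]
    exact Submodule.FG.mul ((Submodule.fg_top _).1 hfg.1) ih

lemma adjoin_eq_top (h0 : 𝒜 0 = Submodule.span k {1})
    (hstd : ∀ n, 𝒜 (n + 1) = 𝒜 1 * 𝒜 n) : Algebra.adjoin k (𝒜 1 : Set R) = ⊤ := by
  have H : ∀ n, ∀ x ∈ 𝒜 n, x ∈ Algebra.adjoin k (𝒜 1 : Set R) := by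
    intro n
    induction n with
    | zero =>
      intro x hx
      rw [h0, Submodule.mem_span_singleton] at hx
      obtain ⟨a, rfl⟩ := hx
      exact Subalgebra.smul_mem _ (one_mem _) _
    | succ n ih =>
      intro x hx
      rw [hstd] at hx
      induction hx using Submodule.mul_induction_on' with
      | mem_mul_mem a ha b hb => exact mul_mem (Algebra.subset_adjoin ha) (ih b hb)
      | add x _ y _ hx hy => exact add_mem hx hy
  rw [eq_top_iff]
  intro x _
  obtain ⟨s, hs⟩ := sum_proj 𝒜 x
  rw [← hs]
  exact sum_mem fun i _ => H i _ (proj_mem 𝒜 _ _)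

lemma noeth (h0 : 𝒜 0 = Submodule.span k {1})
    (hstd : ∀ n, 𝒜 (n + 1) = 𝒜 1 * 𝒜 n)
    (hfg : FiniteDimensional k (𝒜 1)) : IsNoetherianRing R := by
  have : Algebra.FiniteType k R := by
    obtain ⟨s, hs⟩ := (Submodule.fg_top _).1 hfg.1
    refine ⟨⟨s, ?_⟩⟩
    rw [← adjoin_eq_top 𝒜 h0 hstd, ← hs, Algebra.adjoin_span]
  exact Algebra.FiniteType.isNoetherianRing k R

lemma span_piece (hstd : ∀ n, 𝒜 (n + 1) = 𝒜 1 * 𝒜 n) (n : ℕ) : Ideal.span (𝒜 1 : Set R) ^ n = Ideal.span (𝒜 n : Set R) := by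
  induction n with
  | zero =>
    rw [pow_zero, Ideal.one_eq_top, eq_comm, Ideal.eq_top_iff_one]
    exact Ideal.subset_span (SetLike.GradedOne.one_mem)
  | succ n ih =>
    rw [pow_succ', ih]
    apply le_antisymm
    · rw [Ideal.span_mul_span', Ideal.span_le]
      rintro _ ⟨a, ha, b, hb, rfl⟩
      refine Ideal.subset_span ?_
      change a * b ∈ 𝒜 (n + 1)
      rw [hstd]
      exact Submodule.mul_mem_mul ha hb
    · rw [Ideal.span_le]
      intro x hx
      change x ∈ 𝒜 (n + 1) at hx
      rw [hstd] at hx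

      induction hx using Submodule.mul_induction_on' with
      | mem_mul_mem a ha b hb =>
        exact Ideal.mul_mem_mul (Ideal.subset_span ha) (Ideal.subset_span hb)
      | add x _ y _ hx hy => exact add_mem hx hy

lemma irrelevant_eq (hstd : ∀ n, 𝒜 (n + 1) = 𝒜 1 * 𝒜 n) : irrelevantIdeal 𝒜 = Ideal.span (𝒜 1 : Set R) := by
  apply le_antisymm
  · rw [irrelevantIdeal, Ideal.span_le]
    intro x hx
    simp only [Set.mem_Ioi, Set.mem_iUnion, exists_prop] at hx
    obtain ⟨n, hn, hx⟩ := hx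
    have : Ideal.span (𝒜 n : Set R) ≤ Ideal.span (𝒜 1 : Set R) := by
      rw [← span_piece 𝒜 hstd n]
      exact Ideal.pow_le_self hn.ne'
    exact this (Ideal.subset_span hx)
  · apply Ideal.span_mono
    intro x hx
    simp only [Set.mem_Ioi, Set.mem_iUnion, exists_prop]
    exact ⟨1, one_pos, hx⟩

lemma irr_pow_le_iff (hstd : ∀ n, 𝒜 (n + 1) = 𝒜 1 * 𝒜 n) (n : ℕ) (K : Ideal R) :
    irrelevantIdeal 𝒜 ^ n ≤ K ↔ ∀ x ∈ 𝒜 n, x ∈ K := by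
  rw [irrelevant_eq 𝒜 hstd, span_piece 𝒜 hstd, Ideal.span_le]; rfl

lemma piece_le_mono (hstd : ∀ n, 𝒜 (n + 1) = 𝒜 1 * 𝒜 n) {m n : ℕ} (hmn : m ≤ n) {K : Ideal R} (h : ∀ x ∈ 𝒜 m, x ∈ K) :
    ∀ x ∈ 𝒜 n, x ∈ K := by
  rw [← irr_pow_le_iff 𝒜 hstd] at h ⊢
  exact (Ideal.pow_le_pow_right hmn).trans h

lemma gpd_eq_zero_iff (h0 : 𝒜 0 = Submodule.span k {1})
    (hstd : ∀ n, 𝒜 (n + 1) = 𝒜 1 * 𝒜 n)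
    (hfg : FiniteDimensional k (𝒜 1)) (K : Ideal R) (m : ℕ) :
    gradedPieceDim 𝒜 K m = 0 ↔ ∀ x ∈ 𝒜 m, x ∈ K := by
  have : Module.Finite k (𝒜 m) := Module.Finite.iff_fg.2 (piece_fg 𝒜 h0 hstd hfg m)
  rw [gradedPieceDim, Module.finrank_eq_zero_iff_of_free, Submodule.Quotient.subsingleton_iff,
    Submodule.eq_top_iff']
  simp

/-- a homogeneous ideal with an element of degree 1 outside is in the irrelevant ideal -/
lemma irr_ne_top [Nontrivial R] : irrelevantIdeal 𝒜 ≠ ⊤ := by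
  have : irrelevantIdeal 𝒜 ≤ (HomogeneousIdeal.irrelevant 𝒜).toIdeal := by
    rw [HomogeneousIdeal.irrelevant_eq_span]; rfl
  intro h
  rw [h, top_le_iff, Ideal.eq_top_iff_one] at this
  have h1 : proj 𝒜 0 (1 : R) = 0 := this
  rw [proj_self 𝒜 SetLike.GradedOne.one_mem] at h1
  exact one_ne_zero h1

lemma hom_le_irr (h0 : 𝒜 0 = Submodule.span k {1}) {P : Ideal R} (hP : P.IsHomogeneous 𝒜) (hne : P ≠ ⊤) :
    P ≤ irrelevantIdeal 𝒜 := by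
  have e : (HomogeneousIdeal.irrelevant 𝒜).toIdeal = irrelevantIdeal 𝒜 := by
    rw [HomogeneousIdeal.irrelevant_eq_span]; rfl
  rw [← e]
  intro x hx
  change proj 𝒜 0 x = 0
  have h1 : proj 𝒜 0 x ∈ P := hP 0 hx
  have h2 := proj_mem 𝒜 0 x
  rw [h0, Submodule.mem_span_singleton] at h2
  obtain ⟨a, ha⟩ := h2
  by_contra hcon
  apply hne
  have ha0 : a ≠ 0 := by rintro rfl; apply hcon; rw [← ha, zero_smul]
  rw [Ideal.eq_top_iff_one]
  have : (1 : R) = algebraMap k R a⁻¹ * proj 𝒜 0 x := by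
    rw [← ha, ← Algebra.smul_def, smul_smul, inv_mul_cancel₀ ha0, one_smul]
  rw [this]
  exact P.mul_mem_left _ h1

end
end FThr
namespace FThr

open GradedRing

section
variable {k R : Type*} [Field k] [CommRing R] [Algebra k R]
    (𝒜 : ℕ → Submodule k R) [GradedAlgebra 𝒜]

lemma no_chain (hdim : ringKrullDim R = 2) {P0 P1 P2 P3 : Ideal R}
    (i0 : P0.IsPrime) (i1 : P1.IsPrime) (i2 : P2.IsPrime) (i3 : P3.IsPrime)
    (h01 : P0 < P1) (h12 : P1 < P2) (h23 : P2 < P3) : False := by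
  let l : LTSeries (PrimeSpectrum R) :=
    { length := 3
      toFun := ![⟨P0, i0⟩, ⟨P1, i1⟩, ⟨P2, i2⟩, ⟨P3, i3⟩]
      step := by
        intro i
        fin_cases i
        · exact h01
        · exact h12
        · exact h23 }
  have h := Order.LTSeries.length_le_krullDim l
  change _ ≤ ringKrullDim R at h
  rw [hdim] at h
  have h2 : ((3 : ℕ) : WithBot ℕ∞) ≤ ((2 : ℕ) : WithBot ℕ∞) := h
  have h3 : (3 : ℕ) ≤ 2 := by exact_mod_cast h2
  omega

lemma exists_hom_prime {J : Ideal R} (hJ : J.IsHomogeneous 𝒜) {y : R}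
    (hy : y ∉ J.radical) : ∃ P : Ideal R, P.IsPrime ∧ P.IsHomogeneous 𝒜 ∧ J ≤ P ∧ y ∉ P := by
  rw [hJ.radical_eq] at hy
  simp only [Submodule.mem_sInf, Set.mem_ofPred_eq, not_forall] at hy
  obtain ⟨P, ⟨h1, h2, h3⟩, h4⟩ := hy
  exact ⟨P, h3, h1, h2, h4⟩

lemma exists_gt [Nontrivial R] (h0 : 𝒜 0 = Submodule.span k {1}) {P : Ideal R}
    (hP : P.IsPrime) (hPh : P.IsHomogeneous 𝒜)
    {y : R} (hy1 : y ∈ 𝒜 1) (hy : y ∉ P) : ∃ Q : Ideal R, Q.IsPrime ∧ P < Q := by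
  obtain ⟨Q, hQ, hle⟩ := Ideal.exists_le_maximal _ (irr_ne_top 𝒜)
  refine ⟨Q, hQ.isPrime, lt_of_le_of_ne ((hom_le_irr 𝒜 h0 hPh hP.ne_top).trans hle) ?_⟩
  rintro rfl
  apply hy
  apply hle
  apply Ideal.subset_span
  simp only [Set.mem_Ioi, Set.mem_iUnion, exists_prop]
  exact ⟨1, one_pos, hy1⟩

lemma irr_le_rad_iff (hstd : ∀ n, 𝒜 (n + 1) = 𝒜 1 * 𝒜 n) {J : Ideal R} :
    irrelevantIdeal 𝒜 ≤ J.radical ↔ ∀ y ∈ 𝒜 1, y ∈ J.radical := by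
  rw [irrelevant_eq 𝒜 hstd, Ideal.span_le]; rfl

lemma exists_bound (h0 : 𝒜 0 = Submodule.span k {1})
    (hstd : ∀ n, 𝒜 (n + 1) = 𝒜 1 * 𝒜 n) (hfg : FiniteDimensional k (𝒜 1)) {J : Ideal R}
    (h : ∀ y ∈ 𝒜 1, y ∈ J.radical) : ∃ C, ∀ i ≥ C, ∀ x ∈ 𝒜 i, x ∈ J := by
  have := noeth 𝒜 h0 hstd hfg
  rw [← irr_le_rad_iff 𝒜 hstd] at h
  obtain ⟨C, hC⟩ := Ideal.exists_pow_le_of_le_radical_of_fg h (IsNoetherian.noetherian _)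
  refine ⟨C, fun i hi => ?_⟩
  rw [← irr_pow_le_iff 𝒜 hstd]
  exact (Ideal.pow_le_pow_right hi).trans hC

lemma dim_gt [IsDomain R] (h0 : 𝒜 0 = Submodule.span k {1})
    (hstd : ∀ n, 𝒜 (n + 1) = 𝒜 1 * 𝒜 n) (hfg : FiniteDimensional k (𝒜 1))
    (hdim : ringKrullDim R = 2) {u : R} (hu : u ∈ 𝒜 1) :
    ∃ y ∈ 𝒜 1, y ∉ (Ideal.span {u}).radical := by
  by_contra! hcon
  obtain ⟨C, hC⟩ := exists_bound 𝒜 h0 hstd hfg hcon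
  let _ : Algebra (Polynomial k) R := (Polynomial.aeval u).toAlgebra
  have hmap : ∀ q : Polynomial k, algebraMap (Polynomial k) R q = Polynomial.aeval u q :=
    fun _ => rfl
  have : IsScalarTower k (Polynomial k) R := IsScalarTower.of_algebraMap_eq fun c => by
    rw [hmap, Polynomial.algebraMap_eq, Polynomial.aeval_C]
  choose S hS using piece_fg 𝒜 h0 hstd hfg
  have hfin : Module.Finite (Polynomial k) R := by
    classical
    refine ⟨⟨(Finset.range (C + 1)).biUnion S, ?_⟩⟩
    set T := Submodule.span (Polynomial k)
      (((Finset.range (C + 1)).biUnion S : Finset R) : Set R) with hT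
    have H : ∀ i, ∀ x ∈ 𝒜 i, x ∈ T := by
      intro i
      induction i with
      | zero =>
        intro x hx
        rw [← hS] at hx
        have : (S 0 : Set R) ⊆ T := fun z hz => Submodule.subset_span (by
          simp only [Finset.coe_biUnion, Set.mem_iUnion]
          exact ⟨0, by simp, hz⟩)
        exact (Submodule.span_le (p := T.restrictScalars k)).2 this hx
      | succ i ih =>
        intro x hx
        by_cases hi : i + 1 ≤ C
        · rw [← hS] at hx
          have : (S (i+1) : Set R) ⊆ T := fun z hz => Submodule.subset_span (by
            simp only [Finset.coe_biUnion, Set.mem_iUnion]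
            exact ⟨i + 1, by simp; omega, hz⟩)
          exact (Submodule.span_le (p := T.restrictScalars k)).2 this hx
        · have h1 := hC (i + 1) (by omega) x hx
          rw [Ideal.mem_span_singleton'] at h1
          obtain ⟨a, ha⟩ := h1
          have h2 := proj_mul_of_le 𝒜 (a := a) hu (show 1 ≤ i + 1 by omega)
          rw [ha, proj_self 𝒜 hx] at h2
          have h3 := ih _ (proj_mem 𝒜 i a)
          have h4 := T.smul_mem (Polynomial.X : Polynomial k) h3
          rw [Algebra.smul_def, hmap, Polynomial.aeval_X, mul_comm] at h4
          rw [h2]; exact h4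
    rw [eq_top_iff]
    intro x _
    obtain ⟨s, hs⟩ := sum_proj 𝒜 x
    rw [← hs]
    exact sum_mem fun i _ => H i _ (proj_mem 𝒜 _ _)
  have hintg : Algebra.IsIntegral (Polynomial k) R := inferInstance
  have hle : ringKrullDim R ≤ 1 := by
    refine iSup_le fun l => ?_
    by_contra hl
    have hl2 : 2 ≤ l.length := by
      by_contra hh
      apply hl
      have : l.length ≤ 1 := by omega
      exact_mod_cast this
    let P0 := l.toFun ⟨0, by omega⟩
    let P1 := l.toFun ⟨1, by omega⟩
    let P2 := l.toFun ⟨2, by omega⟩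
    have h01 : P0 < P1 := l.strictMono (by simp [Fin.lt_def])
    have h12 : P1 < P2 := l.strictMono (by simp [Fin.lt_def])
    have hne : P1.asIdeal ≠ ⊥ := by
      intro h
      have : P0.asIdeal < P1.asIdeal := h01
      rw [h] at this
      exact not_lt_bot this
    have := P1.2
    have hp := Ideal.comap_isPrime (algebraMap (Polynomial k) R) P1.asIdeal
    have hb := Ideal.IsIntegral.comap_ne_bot (Polynomial k) hne
    have hm : (P1.asIdeal.comap (algebraMap (Polynomial k) R)).IsMaximal :=
      Ideal.IsPrime.isMaximal hp hb
    have hm2 := Ideal.IsIntegral.isMaximal_of_isMaximal_comap P1.asIdeal hm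
    exact P2.2.ne_top (hm2.1.2 _ h12)
  rw [hdim] at hle
  have h2 : ((2 : ℕ) : WithBot ℕ∞) ≤ ((1 : ℕ) : WithBot ℕ∞) := hle
  have h3 : (2 : ℕ) ≤ 1 := by exact_mod_cast h2
  omega

lemma exists_comp {P Q : Ideal R} (hP : P.IsHomogeneous 𝒜)
    (h : ¬ P ≤ Q) : ∃ d, ∃ x ∈ 𝒜 d, x ∈ P ∧ x ∉ Q := by
  obtain ⟨x, hx, hxQ⟩ := SetLike.not_le_iff_exists.1 h
  by_contra! hcon
  apply hxQ
  obtain ⟨s, hs⟩ := sum_proj 𝒜 x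
  rw [← hs]
  exact sum_mem fun i _ => hcon i _ (proj_mem 𝒜 _ _) (hP i hx)

lemma avoid_one {P : Ideal R} (hP : P.IsPrime) (hPh : P.IsHomogeneous 𝒜)
    {y : R} (hy1 : y ∈ 𝒜 1) (hy : y ∉ P) (F : Finset (Ideal R))
    (hF : ∀ Q ∈ F, Q.IsHomogeneous 𝒜 ∧ ¬ Q ≤ P) :
    ∃ e > 0, ∃ a ∈ 𝒜 e, a ∉ P ∧ ∀ Q ∈ F, a ∈ Q := by
  classical
  induction F using Finset.induction_on with
  | empty => exact ⟨1, one_pos, y, hy1, hy, by simp⟩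
  | insert Q F _ ih =>
    obtain ⟨e, he, a, ha, haP, haF⟩ := ih fun Q' h => hF Q' (Finset.mem_insert_of_mem h)
    obtain ⟨hQ, hQP⟩ := hF Q (Finset.mem_insert_self _ _)
    obtain ⟨d, x, hx, hxQ, hxP⟩ := exists_comp 𝒜 hQ hQP
    refine ⟨e + d, by omega, a * x, SetLike.GradedMul.mul_mem ha hx, ?_, ?_⟩
    · intro h; exact (hP.mem_or_mem h).elim haP hxP
    · intro Q' hQ'
      rcases Finset.mem_insert.1 hQ' with rfl | h
      · exact Ideal.mul_mem_left _ _ hxQ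
      · exact Ideal.mul_mem_right _ _ (haF Q' h)

lemma avoid (F : Finset (Ideal R))
    (hF : ∀ P ∈ F, P.IsPrime ∧ P.IsHomogeneous 𝒜 ∧ ∃ y ∈ 𝒜 1, y ∉ P)
    (hinc : ∀ P ∈ F, ∀ Q ∈ F, Q ≤ P → Q = P) :
    ∃ E > 0, ∃ v ∈ 𝒜 E, ∀ P ∈ F, v ∉ P := by
  classical
  have H : ∀ P : Ideal R, ∃ e > 0, ∃ a ∈ 𝒜 e, P ∈ F → a ∉ P ∧ ∀ Q ∈ F.erase P, a ∈ Q := by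
    intro P
    by_cases hPF : P ∈ F
    · obtain ⟨h1, h2, y, hy1, hy⟩ := hF P hPF
      obtain ⟨e, he, a, ha, h3, h4⟩ := avoid_one 𝒜 h1 h2 hy1 hy (F.erase P) (by
        intro Q hQ
        rw [Finset.mem_erase] at hQ
        exact ⟨(hF Q hQ.2).2.1, fun hle => hQ.1 (hinc P hPF Q hQ.2 hle)⟩)
      exact ⟨e, he, a, ha, fun _ => ⟨h3, h4⟩⟩
    · exact ⟨1, one_pos, 0, zero_mem _, fun h => absurd h hPF⟩
  choose e he a ha hA using H
  have hE : ∀ P ∈ F, ∃ c, 0 < c ∧ c * e P = ∏ P ∈ F, e P := by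
    intro P hP
    refine ⟨∏ Q ∈ F.erase P, e Q, Finset.prod_pos fun Q _ => he Q, ?_⟩
    exact Finset.prod_erase_mul _ _ hP
  choose! c hc hce using hE
  refine ⟨∏ P ∈ F, e P, Finset.prod_pos fun Q _ => he Q, ∑ P ∈ F, a P ^ c P, ?_, ?_⟩
  · refine sum_mem fun P hP => ?_
    rw [← hce P hP]
    exact SetLike.pow_mem_graded (c P) (ha P)
  · intro P hP hmem
    obtain ⟨h1, _⟩ := hF P hP
    rw [← Finset.add_sum_erase _ _ hP] at hmem
    have h2 : ∑ Q ∈ F.erase P, a Q ^ c Q ∈ P := by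
      refine sum_mem fun Q hQ => ?_
      rw [Finset.mem_erase] at hQ
      exact Ideal.pow_mem_of_mem _ ((hA Q hQ.2).2 P (Finset.mem_erase.2 ⟨hQ.1.symm, hP⟩)) _
        (hc Q hQ.2)
    exact (hA P hP).1 (h1.mem_of_pow_mem _ ((Ideal.add_mem_iff_left _ h2).1 hmem))

lemma params [IsDomain R] (h0 : 𝒜 0 = Submodule.span k {1})
    (hstd : ∀ n, 𝒜 (n + 1) = 𝒜 1 * 𝒜 n) (hfg : FiniteDimensional k (𝒜 1))
    (hdim : ringKrullDim R = 2) :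
    ∃ b > 0, ∃ u ∈ 𝒜 b, ∃ v ∈ 𝒜 b, u ≠ 0 ∧ ∃ C, ∀ i ≥ C, ∀ x ∈ 𝒜 i,
      x ∈ Ideal.span ({u, v} : Set R) := by
  have := noeth 𝒜 h0 hstd hfg
  obtain ⟨u0, hu0, hu0'⟩ : ∃ u ∈ 𝒜 1, u ≠ 0 := by
    obtain ⟨y, hy, hy'⟩ := dim_gt 𝒜 h0 hstd hfg hdim (zero_mem (𝒜 1))
    exact ⟨y, hy, fun h => hy' (by rw [h]; exact Ideal.zero_mem _)⟩
  have hfin := (Ideal.span {u0}).finite_minimalPrimes_of_isNoetherianRing R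
  have hhom0 : (Ideal.span {u0}).IsHomogeneous 𝒜 :=
    Ideal.homogeneous_span 𝒜 _ (by rintro x rfl; exact ⟨1, hu0⟩)
  have hmh : ∀ P ∈ (Ideal.span {u0}).minimalPrimes, P.IsHomogeneous 𝒜 := by
    intro P hP
    have h1 : (P.homogeneousCore 𝒜).toIdeal.IsPrime := Ideal.IsPrime.homogeneousCore hP.1.1
    have h2 : Ideal.span {u0} ≤ (P.homogeneousCore 𝒜).toIdeal := by
      rw [Ideal.span_singleton_le_iff_mem]
      exact Ideal.mem_homogeneousCore_of_homogeneous_of_mem ⟨1, hu0⟩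
        ((Ideal.span_singleton_le_iff_mem _).1 hP.1.2)
    have h3 := Ideal.toIdeal_homogeneousCore_le 𝒜 P
    rw [Ideal.IsHomogeneous.iff_eq]
    exact le_antisymm h3 (hP.2 ⟨h1, h2⟩ h3)
  obtain ⟨E, hE, v, hv, hvP⟩ := avoid 𝒜 hfin.toFinset (by
    intro P hP
    rw [Set.Finite.mem_toFinset] at hP
    refine ⟨hP.1.1, hmh P hP, ?_⟩
    by_contra! hcon
    have h1 : irrelevantIdeal 𝒜 ≤ P := by
      rw [irrelevant_eq 𝒜 hstd, Ideal.span_le]; exact hcon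
    obtain ⟨y, hy, hy'⟩ := dim_gt 𝒜 h0 hstd hfg hdim hu0
    apply hy'
    rw [← Ideal.sInf_minimalPrimes, Submodule.mem_sInf]
    intro Q hQ
    have hQP : Q ≤ P := (hom_le_irr 𝒜 h0 (hmh Q hQ) hQ.1.1.ne_top).trans h1
    exact hP.2 hQ.1 hQP (hcon y hy))
    (by
      intro P hP Q hQ hle
      rw [Set.Finite.mem_toFinset] at hP hQ
      exact le_antisymm hle (hP.2 hQ.1 hle))
  refine ⟨E, hE, u0 ^ E, by simpa using SetLike.pow_mem_graded E hu0, v, hv,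
    pow_ne_zero _ hu0', ?_⟩
  apply exists_bound 𝒜 h0 hstd hfg
  intro y hy
  by_contra hcon
  obtain ⟨Q, hQ, hQh, hle, hyQ⟩ := exists_hom_prime 𝒜 (Ideal.homogeneous_span 𝒜 _ (by
    rintro x (rfl | rfl)
    · exact ⟨E, by simpa using SetLike.pow_mem_graded E hu0⟩
    · exact ⟨E, hv⟩)) hcon
  have hu0Q : u0 ∈ Q := hQ.mem_of_pow_mem E (hle (Ideal.subset_span (by simp)))
  have hvQ : v ∈ Q := hle (Ideal.subset_span (by simp))
  obtain ⟨P, hP, hPQ⟩ := Ideal.exists_minimalPrimes_le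
    ((Ideal.span_singleton_le_iff_mem Q).2 hu0Q)
  obtain ⟨Q3, hQ3, hlt⟩ := exists_gt 𝒜 h0 hQ hQh hy hyQ
  refine no_chain hdim (Ideal.isPrime_bot) hP.1.1 hQ hQ3 ?_ ?_ hlt
  · rw [bot_lt_iff_ne_bot]
    rintro rfl
    exact hu0' ((Ideal.span_singleton_le_iff_mem _).1 hP.1.2)
  · refine lt_of_le_of_ne hPQ ?_
    rintro rfl
    exact hvP P (by rwa [Set.Finite.mem_toFinset]) hvQ

end
end FThr
namespace FThr

open GradedRing

section
variable {k R : Type*} [Field k] [CommRing R] [Algebra k R]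
    (𝒜 : ℕ → Submodule k R) [GradedAlgebra 𝒜]

/-- Vanishing of the first Koszul homology of `u, v` on `R` in large degrees. -/
lemma koszul_vanish [IsNoetherianRing R] {b : ℕ} {u v : R} (hu : u ∈ 𝒜 b) (hv : v ∈ 𝒜 b)
    {C : ℕ} (hC : ∀ i ≥ C, ∀ x ∈ 𝒜 i, x ∈ Ideal.span ({u, v} : Set R)) :
    ∃ C', ∀ i ≥ C', ∀ t ∈ 𝒜 i, v * t ∈ Ideal.span {u} → t ∈ Ideal.span {u} := by
  have huh : (Ideal.span {u}).IsHomogeneous 𝒜 :=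
    Ideal.homogeneous_span 𝒜 _ (by rintro x rfl; exact ⟨b, hu⟩)
  let S : Set R := {t | v * t ∈ Ideal.span {u} ∧ ∃ d, t ∈ 𝒜 d}
  have hS : ∀ t, t ∈ S ↔ v * t ∈ Ideal.span {u} ∧ ∃ d, t ∈ 𝒜 d := fun t => Iff.rfl
  obtain ⟨S', hsub, hspan⟩ := (Submodule.fg_span_iff_fg_span_finset_subset S).1
    (IsNoetherian.noetherian (Ideal.span S))
  have hdeg : ∀ g : R, ∃ d, g ∈ S' → g ∈ 𝒜 d := by
    intro g
    by_cases hg : g ∈ S'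
    · obtain ⟨d, hd⟩ := ((hS g).1 (hsub hg)).2
      exact ⟨d, fun _ => hd⟩
    · exact ⟨0, fun h => absurd h hg⟩
  choose d hd using hdeg
  refine ⟨S'.sup d + C, fun i hi t ht htv => ?_⟩
  have h1 : t ∈ Ideal.span (S' : Set R) := by
    have : t ∈ Ideal.span S := Ideal.subset_span ((hS t).2 ⟨htv, i, ht⟩)
    rw [Ideal.span] at this ⊢
    rwa [← hspan]
  rw [← proj_self 𝒜 ht]
  refine proj_mem_of_span 𝒜 ?_ h1
  intro g hg
  refine ⟨d g, hd g hg, fun r hle hr => ?_⟩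
  have hdg : d g ≤ S'.sup d := Finset.le_sup hg
  have h2 := hC _ (by omega) r hr
  rw [Ideal.mem_span_pair] at h2
  obtain ⟨x, y, rfl⟩ := h2
  have h3 : (x * u + y * v) * g = (x * g) * u + y * (v * g) := by ring
  rw [h3]
  exact Ideal.add_mem _ (Ideal.mul_mem_left _ _ (Ideal.mem_span_singleton_self u))
    (Ideal.mul_mem_left _ _ ((hS g).1 (hsub hg)).1)

lemma gens_split {b : ℕ} {u v : R} (hu : u ∈ 𝒜 b) (hv : v ∈ 𝒜 b)
    {C : ℕ} (hC : ∀ i ≥ C, ∀ x ∈ 𝒜 i, x ∈ Ideal.span ({u, v} : Set R))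
    {G : Set R} {B : ℕ} (hG : ∀ g ∈ G, ∃ d ≤ B, g ∈ 𝒜 d) {m : ℕ} (hm : B + C ≤ m + b)
    {w : R} (hw : w ∈ 𝒜 (m + b)) (hwG : w ∈ Ideal.span G) :
    ∃ a ∈ 𝒜 m, ∃ c ∈ 𝒜 m, a ∈ Ideal.span G ∧ c ∈ Ideal.span G ∧ w = u * a + v * c := by
  have hGh : (Ideal.span G).IsHomogeneous 𝒜 :=
    Ideal.homogeneous_span 𝒜 _ (fun g hg => by obtain ⟨d, _, hd⟩ := hG g hg; exact ⟨d, hd⟩)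
  have h1 : w ∈ Ideal.span {u} * Ideal.span G ⊔ Ideal.span {v} * Ideal.span G := by
    rw [← proj_self 𝒜 hw]
    refine proj_mem_of_span 𝒜 ?_ hwG
    intro g hg
    obtain ⟨d, hdB, hd⟩ := hG g hg
    refine ⟨d, hd, fun r hle hr => ?_⟩
    have h2 := hC _ (by omega) r hr
    rw [Ideal.mem_span_pair] at h2
    obtain ⟨x, y, rfl⟩ := h2
    have h3 : (x * u + y * v) * g = u * (x * g) + v * (y * g) := by ring
    rw [h3]
    have hg' := Ideal.subset_span (α := R) hg
    exact Submodule.add_mem_sup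
      (Ideal.mul_mem_mul (Ideal.mem_span_singleton_self u) (Ideal.mul_mem_left _ _ hg'))
      (Ideal.mul_mem_mul (Ideal.mem_span_singleton_self v) (Ideal.mul_mem_left _ _ hg'))
  obtain ⟨x, hx, y, hy, hxy⟩ := Submodule.mem_sup.1 h1
  obtain ⟨a, ha, rfl⟩ := Ideal.mem_span_singleton_mul.1 hx
  obtain ⟨c, hc, rfl⟩ := Ideal.mem_span_singleton_mul.1 hy
  refine ⟨proj 𝒜 m a, proj_mem _ _ _, proj 𝒜 m c, proj_mem _ _ _, hGh m ha, hGh m hc, ?_⟩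
  have h4 := congrArg (proj 𝒜 (m + b)) hxy
  rw [map_add, proj_self 𝒜 hw, mul_comm u, mul_comm v, proj_mul_of_le 𝒜 hu (by omega),
    proj_mul_of_le 𝒜 hv (by omega), Nat.add_sub_cancel] at h4
  rw [← h4]; ring

/-- the degree `n` part of `K` inside `𝒜 n` -/
def cutI (K : Ideal R) (n : ℕ) : Submodule k (𝒜 n) :=
  Submodule.comap (𝒜 n).subtype (K.restrictScalars k)

lemma mem_cutI (K : Ideal R) (n : ℕ) (x : 𝒜 n) : x ∈ cutI 𝒜 K n ↔ (x : R) ∈ K := Iff.rfl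

/-- multiplication by a homogeneous element on graded pieces -/
def mulPiece {b : ℕ} {u : R} (hu : u ∈ 𝒜 b) (n : ℕ) : 𝒜 n →ₗ[k] 𝒜 (n + b) :=
  (LinearMap.mulRight k u).restrict (fun _ hx => SetLike.GradedMul.mul_mem hx hu)

lemma mulPiece_coe {b : ℕ} {u : R} (hu : u ∈ 𝒜 b) (n : ℕ) (x : 𝒜 n) :
    (mulPiece 𝒜 hu n x : R) = x * u := rfl

/-- multiplication by a homogeneous element on graded pieces of the quotient -/
def mulQ (K : Ideal R) {b : ℕ} {u : R} (hu : u ∈ 𝒜 b) (n : ℕ) :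
    (𝒜 n ⧸ cutI 𝒜 K n) →ₗ[k] (𝒜 (n + b) ⧸ cutI 𝒜 K (n + b)) :=
  Submodule.mapQ _ _ (mulPiece 𝒜 hu n) (fun _ hx => Ideal.mul_mem_right _ _ hx)

lemma convex_dim [IsDomain R] (h0 : 𝒜 0 = Submodule.span k {1})
    (hstd : ∀ n, 𝒜 (n + 1) = 𝒜 1 * 𝒜 n) (hfg : FiniteDimensional k (𝒜 1))
    {b : ℕ} {u v : R} (hu : u ∈ 𝒜 b) (hv : v ∈ 𝒜 b) (hu0 : u ≠ 0)
    {C : ℕ} (hC : ∀ i ≥ C, ∀ x ∈ 𝒜 i, x ∈ Ideal.span ({u, v} : Set R))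
    {C' : ℕ} (hC' : ∀ i ≥ C', ∀ t ∈ 𝒜 i, v * t ∈ Ideal.span {u} → t ∈ Ideal.span {u})
    {G : Set R} {B : ℕ} (hG : ∀ g ∈ G, ∃ d ≤ B, g ∈ 𝒜 d) {n : ℕ} (hn : B + C + C' ≤ n) :
    2 * gradedPieceDim 𝒜 (Ideal.span G) (n + b) ≤
      gradedPieceDim 𝒜 (Ideal.span G) n + gradedPieceDim 𝒜 (Ideal.span G) (n + b + b) := by
  set K := Ideal.span G with hK
  have hfin : ∀ m, Module.Finite k (𝒜 m) := fun m =>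
    Module.Finite.iff_fg.2 (piece_fg 𝒜 h0 hstd hfg m)
  let Φ := (mulQ 𝒜 K hv n).prod (-(mulQ 𝒜 K hu n))
  let Ψ := (mulQ 𝒜 K hu (n + b)).coprod (mulQ 𝒜 K hv (n + b))
  have hker : LinearMap.ker Ψ ≤ LinearMap.range Φ := by
    rintro ⟨s, t⟩ hst
    obtain ⟨s, rfl⟩ := Submodule.mkQ_surjective _ s
    obtain ⟨t, rfl⟩ := Submodule.mkQ_surjective _ t
    have h1 : (s : R) * u + t * v ∈ K := by
      rw [LinearMap.mem_ker] at hst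
      have h2 : (cutI 𝒜 K (n + b + b)).mkQ
          (mulPiece 𝒜 hu (n + b) s + mulPiece 𝒜 hv (n + b) t) = 0 := by
        rw [map_add]; exact hst
      rw [Submodule.mkQ_apply, Submodule.Quotient.mk_eq_zero, mem_cutI] at h2
      exact h2
    have h1m : (s : R) * u + t * v ∈ 𝒜 (n + b + b) :=
      add_mem (SetLike.GradedMul.mul_mem s.2 hu) (SetLike.GradedMul.mul_mem t.2 hv)
    obtain ⟨a, ha, c, hc, haK, hcK, he⟩ := gens_split 𝒜 hu hv hC hG (by omega) h1m h1
    have h3 : v * (t - c : R) ∈ Ideal.span {u} := by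
      rw [Ideal.mem_span_singleton']
      exact ⟨a - s, by linear_combination -he⟩
    have h4 := hC' (n + b) (by omega) (t - c) (sub_mem t.2 hc) h3
    rw [Ideal.mem_span_singleton'] at h4
    obtain ⟨w, hw⟩ := h4
    have h5 : proj 𝒜 n w * u = t - c := by
      have h6 := congrArg (proj 𝒜 (n + b)) hw
      rw [proj_mul_of_le 𝒜 hu (by omega), proj_self 𝒜 (sub_mem t.2 hc), Nat.add_sub_cancel] at h6
      exact h6
    have h7 : (s : R) - a = - (proj 𝒜 n w * v) := by
      apply mul_right_cancel₀ hu0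
      linear_combination he + v * h5
    refine ⟨(cutI 𝒜 K n).mkQ ⟨- proj 𝒜 n w, neg_mem (proj_mem 𝒜 n w)⟩, ?_⟩
    apply Prod.ext
    · change (cutI 𝒜 K (n + b)).mkQ (mulPiece 𝒜 hv n _) = (cutI 𝒜 K (n + b)).mkQ s
      rw [← sub_eq_zero, ← map_sub, Submodule.mkQ_apply, Submodule.Quotient.mk_eq_zero, mem_cutI]
      have : ((mulPiece 𝒜 hv n ⟨- proj 𝒜 n w, neg_mem (proj_mem 𝒜 n w)⟩ - s : 𝒜 (n + b)) : R)
        = - a := by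
        rw [Submodule.coe_sub, mulPiece_coe]
        linear_combination -h7
      rw [this]; exact neg_mem haK
    · change -(cutI 𝒜 K (n + b)).mkQ (mulPiece 𝒜 hu n _) = (cutI 𝒜 K (n + b)).mkQ t
      rw [← map_neg, ← sub_eq_zero, ← map_sub, Submodule.mkQ_apply,
        Submodule.Quotient.mk_eq_zero, mem_cutI]
      have : ((-mulPiece 𝒜 hu n ⟨- proj 𝒜 n w, neg_mem (proj_mem 𝒜 n w)⟩ - t : 𝒜 (n + b)) : R)
        = - c := by
        rw [Submodule.coe_sub, Submodule.coe_neg, mulPiece_coe]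
        linear_combination h5
      rw [this]; exact neg_mem hcK
  have e1 := LinearMap.finrank_range_add_finrank_ker Ψ
  rw [Module.finrank_prod] at e1
  have e2 := Submodule.finrank_le (LinearMap.range Ψ)
  have e3 := Submodule.finrank_mono hker
  have e4 := LinearMap.finrank_range_le Φ
  change 2 * Module.finrank k (𝒜 (n + b) ⧸ cutI 𝒜 K (n + b)) ≤
    Module.finrank k (𝒜 n ⧸ cutI 𝒜 K n) +
      Module.finrank k (𝒜 (n + b + b) ⧸ cutI 𝒜 K (n + b + b))
  omega

lemma seq_decay (g : ℕ → ℕ) (hconv : ∀ i, 2 * g (i + 1) ≤ g i + g (i + 2)) (T : ℕ)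
    (hT : ∀ i ≥ T, g i = 0) (j : ℕ) (hj : g j ≠ 0) : j + 1 ≤ g 0 := by
  have hdec : ∀ n i, T ≤ i + n → g i ≠ 0 → g (i + 1) < g i := by
    intro n
    induction n with
    | zero => intro i hi hg; exact absurd (hT i hi) hg
    | succ n ih =>
      intro i hi hg
      by_cases h : g (i + 1) = 0
      · omega
      · have := ih (i + 1) (by omega) h
        have := hconv i
        have e : i + 1 + 1 = i + 2 := rfl
        rw [e] at *
        omega
  have H : ∀ n ≤ j, g (j - n) ≥ n + 1 := by
    intro n
    induction n with
    | zero => intro _; simp; omega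
    | succ n ih =>
      intro hn
      have h1 := ih (by omega)
      have e : j - n = (j - (n + 1)) + 1 := by omega
      have h2 := hconv (j - (n + 1))
      rw [e] at h1
      have h3 := hdec T (j - (n + 1) + 1) (by omega) (by omega)
      have e : j - (n + 1) + 1 + 1 = j - (n + 1) + 2 := rfl
      rw [e] at h3
      omega
  simpa using H j le_rfl

end
end FThr
namespace FThr

open GradedRing

section
variable {k R : Type*} [Field k] [CommRing R] [Algebra k R]
    (𝒜 : ℕ → Submodule k R) [GradedAlgebra 𝒜]

lemma gpd_congr {K K' : Ideal R} {m : ℕ} (h : ∀ x ∈ 𝒜 m, x ∈ K ↔ x ∈ K') :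
    gradedPieceDim 𝒜 K m = gradedPieceDim 𝒜 K' m := by
  have : Submodule.comap (𝒜 m).subtype (K.restrictScalars k)
      = Submodule.comap (𝒜 m).subtype (K'.restrictScalars k) := by
    ext x; exact h x x.2
  unfold gradedPieceDim
  rw [this]

/-- homogeneous elements of `I` of degree at most `D` -/
def SD (I : Ideal R) (D : ℕ) : Set R := {g | g ∈ I ∧ ∃ d ≤ D, g ∈ 𝒜 d}

lemma frob_span (p : ℕ) [ExpChar R p] (n : ℕ) (S : Set R) :
    (Ideal.span S).frobPow (p ^ n) = Ideal.span ((fun f => f ^ p ^ n) '' S) := by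
  have h1 : ∀ T : Set R, (fun f => f ^ p ^ n) '' T = (iterateFrobenius R p n) '' T := by
    intro T; exact Set.image_congr fun x _ => (iterateFrobenius_def p n x).symm
  unfold Ideal.frobPow
  rw [h1, h1]
  exact Ideal.map_span (iterateFrobenius R p n) S

lemma frob_mono {I J : Ideal R} (h : I ≤ J) (q : ℕ) : I.frobPow q ≤ J.frobPow q :=
  Ideal.span_mono (Set.image_mono h)

lemma pow_mem_frob {I : Ideal R} {x : R} (h : x ∈ I) (q : ℕ) : x ^ q ∈ I.frobPow q :=
  Ideal.subset_span ⟨x, h, rfl⟩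

lemma span_hom {I : Ideal R} (hI : I.IsHomogeneous 𝒜) :
    I = Ideal.span {g | g ∈ I ∧ ∃ d, g ∈ 𝒜 d} := by
  apply le_antisymm
  · intro x hx
    obtain ⟨s, hs⟩ := sum_proj 𝒜 x
    rw [← hs]
    exact sum_mem fun i _ => Ideal.subset_span ⟨hI i hx, i, proj_mem 𝒜 _ _⟩
  · rw [Ideal.span_le]; exact fun x hx => hx.1

lemma frob_cut (p : ℕ) [ExpChar R p] (n : ℕ) {I : Ideal R} (hI : I.IsHomogeneous 𝒜) {D m : ℕ}
    (hm : m < p ^ n * (D + 1)) {x : R} (hx : x ∈ 𝒜 m) :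
    x ∈ I.frobPow (p ^ n) ↔ x ∈ (Ideal.span (SD 𝒜 I D)).frobPow (p ^ n) := by
  constructor
  · intro h
    rw [span_hom 𝒜 hI, frob_span] at h
    rw [← proj_self 𝒜 hx]
    refine proj_mem_of_span 𝒜 ?_ h
    rintro _ ⟨g, ⟨hg, d, hd⟩, rfl⟩
    refine ⟨p ^ n * d, by simpa using SetLike.pow_mem_graded (p ^ n) hd, fun r hdm hr => ?_⟩
    have h1 := lt_of_le_of_lt hdm hm
    have h2 := lt_of_mul_lt_mul_left h1 (Nat.zero_le _)
    have h3 : g ∈ SD 𝒜 I D := ⟨hg, d, by omega, hd⟩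
    exact Ideal.mul_mem_left _ _ (pow_mem_frob (Ideal.subset_span h3) _)
  · intro h
    refine frob_mono ?_ _ h
    rw [Ideal.span_le]; exact fun y hy => hy.1

lemma frob_rad (q : ℕ) {J : Ideal R} {y : R} (h : y ∈ J.radical) :
    y ∈ (J.frobPow q).radical := by
  obtain ⟨N, hN⟩ := h
  exact ⟨N * q, by rw [pow_mul]; exact pow_mem_frob hN q⟩

lemma colen_rad {I : Ideal R} (hI : I.IsHomogeneous 𝒜)
    (hcolen : FiniteDimensional k (R ⧸ I)) : ∀ y ∈ 𝒜 1, y ∈ I.radical := by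
  intro y hy
  obtain ⟨P, hPm, hP⟩ := Algebra.IsIntegral.isIntegral (R := k) (Ideal.Quotient.mk I y)
  have h1 : Polynomial.aeval y P ∈ I := by
    rw [← Ideal.Quotient.eq_zero_iff_mem]
    have : Polynomial.aeval (Ideal.Quotient.mkₐ k I y) P = 0 := hP
    rw [Polynomial.aeval_algHom_apply] at this
    exact this
  refine ⟨P.natDegree, ?_⟩
  have h2 := hI P.natDegree h1
  change proj 𝒜 P.natDegree _ ∈ I at h2
  have hpow : ∀ i, y ^ i ∈ 𝒜 i := fun i => by simpa using SetLike.pow_mem_graded i hy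
  rw [Polynomial.aeval_eq_sum_range, map_sum, Finset.sum_range_succ, Finset.sum_eq_zero,
    zero_add, proj_self 𝒜 (Submodule.smul_mem _ _ (hpow _)), Polynomial.coeff_natDegree,
    hPm.leadingCoeff, one_smul] at h2
  · exact h2
  · intro i hi
    exact proj_ne 𝒜 (Submodule.smul_mem _ _ (hpow _)) (Finset.mem_range.1 hi).ne

lemma big_vanish [IsDomain R] (h0 : 𝒜 0 = Submodule.span k {1})
    (hstd : ∀ n, 𝒜 (n + 1) = 𝒜 1 * 𝒜 n) (hfg : FiniteDimensional k (𝒜 1))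
    (hdim : ringKrullDim R = 2) {I : Ideal R} (hI : ∀ y ∈ 𝒜 1, y ∈ I.radical) :
    ∃ M, ∀ q, ∀ m ≥ M * q, ∀ x ∈ 𝒜 m, x ∈ I.frobPow q := by
  obtain ⟨b, hb, u, hu, v, hv, hu0, C, hC⟩ := params 𝒜 h0 hstd hfg hdim
  obtain ⟨a, ha⟩ := exists_bound 𝒜 h0 hstd hfg hI
  have hA : ∀ w ∈ 𝒜 b, w ^ a ∈ I := fun w hw =>
    ha (a * b) (Nat.le_mul_of_pos_right _ hb) _ (by simpa using SetLike.pow_mem_graded a hw)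
  have hC' : irrelevantIdeal 𝒜 ^ C ≤ Ideal.span {u, v} := by
    rw [irr_pow_le_iff 𝒜 hstd]; exact hC C le_rfl
  refine ⟨C * (a + a), fun q m hm => ?_⟩
  rw [← irr_pow_le_iff 𝒜 hstd]
  refine (Ideal.pow_le_pow_right hm).trans ?_
  have e : C * (a + a) * q = C * (a * q + a * q) := by ring
  rw [e, pow_mul]
  refine (Ideal.pow_right_mono hC' _).trans ?_
  rw [Ideal.span_insert]
  refine Ideal.sup_pow_add_le_pow_sup_pow.trans ?_
  rw [Ideal.span_singleton_pow, Ideal.span_singleton_pow, sup_le_iff,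
    Ideal.span_singleton_le_iff_mem, Ideal.span_singleton_le_iff_mem, pow_mul, pow_mul]
  exact ⟨pow_mem_frob (hA u hu) q, pow_mem_frob (hA v hv) q⟩

end
end FThr
namespace FThr

open GradedRing

section
variable {k R : Type*} [Field k] [CommRing R] [Algebra k R]
    (𝒜 : ℕ → Submodule k R) [GradedAlgebra 𝒜]

lemma uniform_s {P M T : Ideal R} (hP : P.IsPrime) (hM : M.FG)
    (h : ∀ w ∈ M, ∃ s ∉ P, s * w ∈ T) : ∃ s ∉ P, ∀ w ∈ M, s * w ∈ T := by
  classical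
  obtain ⟨F, rfl⟩ := hM
  have h' : ∀ w : F, ∃ s ∉ P, s * (w : R) ∈ T := fun w => h _ (Ideal.subset_span w.2)
  choose s hs hsT using h'
  refine ⟨∏ w, s w, fun hmem => ?_, fun w hw => ?_⟩
  · obtain ⟨i, _, hi⟩ := (Ideal.IsPrime.prod_mem_iff).1 hmem
    exact hs i hi
  · induction hw using Submodule.span_induction with
    | mem g hg =>
      rw [← Finset.prod_erase_mul _ _ (Finset.mem_univ (⟨g, hg⟩ : F)), mul_assoc]
      exact Ideal.mul_mem_left _ _ (hsT ⟨g, hg⟩)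
    | zero => simp
    | add x y _ _ hx hy => rw [mul_add]; exact T.add_mem hx hy
    | smul a x _ hx => rw [smul_eq_mul, mul_left_comm]; exact T.mul_mem_left _ hx

lemma prime_local [IsDomain R] [IsNoetherianRing R] {P : Ideal R} [hP : P.IsPrime] {z : R}
    (hz : P ∈ (Ideal.span {z}).minimalPrimes) :
    ∃ N, ∃ s ∉ P, ∀ w ∈ P ^ N, s * w ∈ Ideal.span {z} := by
  have h1 := IsLocalization.AtPrime.radical_map_of_mem_minimalPrimes
    (Localization.AtPrime P) P (Ideal.span {z}) hz
  obtain ⟨N, hN⟩ := Ideal.exists_pow_le_of_le_radical_of_fg h1.ge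
    (IsNoetherian.noetherian _)
  refine ⟨N, uniform_s hP (IsNoetherian.noetherian _) fun w hw => ?_⟩
  have h2 : algebraMap R (Localization.AtPrime P) w ∈
      (Ideal.span {z}).map (algebraMap R (Localization.AtPrime P)) := by
    apply hN
    rw [← Ideal.map_pow]
    exact Ideal.mem_map_of_mem _ hw
  rw [IsLocalization.mem_map_algebraMap_iff P.primeCompl] at h2
  obtain ⟨⟨x, s⟩, hxs⟩ := h2
  refine ⟨s, s.2, ?_⟩
  simp only [← map_mul] at hxs
  have h3 := IsLocalization.injective (Localization.AtPrime P)
    (Ideal.primeCompl_le_nonZeroDivisors P) hxs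
  rw [mul_comm, h3]
  exact x.2

lemma many_indep [IsDomain R] (h0 : 𝒜 0 = Submodule.span k {1})
    (hstd : ∀ n, 𝒜 (n + 1) = 𝒜 1 * 𝒜 n) (hfg : FiniteDimensional k (𝒜 1))
    {P K : Ideal R} (hP : P.IsPrime) {z y s : R} {δ N L q m : ℕ} (hz : z ∈ 𝒜 δ)
    (hz0 : z ≠ 0) (hzP : z ∈ P) (hy1 : y ∈ 𝒜 1) (hy : y ∉ P) (hsP : s ∉ P)
    (hs : ∀ w ∈ P ^ N, s * w ∈ Ideal.span {z}) (hK : K ≤ P ^ q) (hL : N * L ≤ q)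
    (hLm : L * δ ≤ m) : L ≤ gradedPieceDim 𝒜 K m := by
  have hfin : Module.Finite k (𝒜 m) := Module.Finite.iff_fg.2 (piece_fg 𝒜 h0 hstd hfg m)
  have hmem : ∀ i : Fin L, z ^ (i : ℕ) * y ^ (m - i * δ) ∈ 𝒜 m := by
    intro i
    have h1 : (i : ℕ) * δ ≤ m := (Nat.mul_le_mul_right _ i.2.le).trans hLm
    have h2 := SetLike.mul_mem_graded (SetLike.pow_mem_graded (i : ℕ) hz)
      (SetLike.pow_mem_graded (m - i * δ) hy1)
    have e : (i : ℕ) • δ + (m - i * δ) • 1 = m := by simp; omega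
    rwa [e] at h2
  let B : Fin L → 𝒜 m := fun i => ⟨_, hmem i⟩
  have hKs : ∀ w ∈ K, z ^ L ∣ s ^ L * w := by
    intro w hw
    have h1 : Ideal.span {s} * P ^ N ≤ Ideal.span {z} := by
      rw [Ideal.span_singleton_mul_le_iff]
      exact hs
    have h2 := Ideal.pow_right_mono h1 L
    rw [mul_pow, Ideal.span_singleton_pow, Ideal.span_singleton_pow, ← pow_mul] at h2
    rw [← Ideal.mem_span_singleton]
    apply h2
    exact Ideal.mul_mem_mul (Ideal.mem_span_singleton_self _)
      (Ideal.pow_le_pow_right hL (hK hw))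
  have hli : LinearIndependent k (fun i => (Submodule.comap (𝒜 m).subtype
      (K.restrictScalars k)).mkQ (B i)) := by
    rw [Fintype.linearIndependent_iff]
    intro c hc
    simp only [← map_smul, ← map_sum] at hc
    rw [Submodule.mkQ_apply, Submodule.Quotient.mk_eq_zero, Submodule.mem_comap] at hc
    have hc' : ∑ i, c i • (z ^ (i : ℕ) * y ^ (m - i * δ)) ∈ K := by
      have : (𝒜 m).subtype (∑ i, c i • B i) ∈ K := hc
      simpa [B] using this
    suffices H : ∀ n, ∀ i : Fin L, (i : ℕ) = n → c i = 0 from fun i => H i i rfl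
    intro n
    induction n using Nat.strong_induction_on with
    | _ n ih =>
    intro i hi
    have h1 : z ^ (n + 1) ∣ ∑ j ∈ Finset.univ.erase i,
        c j • (z ^ (j : ℕ) * y ^ (m - j * δ)) := by
      apply Finset.dvd_sum
      intro j hj
      rcases lt_trichotomy (j : ℕ) n with h | h | h
      · rw [ih j h j rfl, zero_smul]; exact dvd_zero _
      · exact absurd (Fin.ext (h.trans hi.symm)) (Finset.ne_of_mem_erase hj)
      · rw [Algebra.smul_def]
        exact Dvd.dvd.mul_left (Dvd.dvd.mul_right (pow_dvd_pow z h) _) _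
    obtain ⟨t, ht⟩ := h1
    obtain ⟨r, hr⟩ := hKs _ hc'
    rw [← Finset.add_sum_erase _ _ (Finset.mem_univ i), ht, hi, Algebra.smul_def] at hr
    have hnL : n < L := hi ▸ i.2
    obtain ⟨l, rfl⟩ : ∃ l, L = n + 1 + l := ⟨L - (n + 1), by omega⟩
    have h2 : s ^ (n + 1 + l) * (algebraMap k R (c i) * y ^ (m - n * δ))
        = z * (z ^ l * r - s ^ (n + 1 + l) * t) := by
      apply mul_left_cancel₀ (pow_ne_zero n hz0)
      linear_combination hr
    have h3 : s ^ (n + 1 + l) * (algebraMap k R (c i) * y ^ (m - n * δ)) ∈ P := by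
      rw [h2]; exact P.mul_mem_right _ hzP
    by_contra hci
    rcases hP.mem_or_mem h3 with h4 | h4
    · exact hsP (hP.mem_of_pow_mem _ h4)
    rcases hP.mem_or_mem h4 with h4 | h4
    · exact hP.ne_top (Ideal.eq_top_of_isUnit_mem _ h4
        ((IsUnit.mk0 _ hci).map (algebraMap k R)))
    · exact hy (hP.mem_of_pow_mem _ h4)
  have := hli.fintype_card_le_finrank
  rw [Fintype.card_fin] at this
  exact this

lemma exists_prime_data [IsDomain R] (h0 : 𝒜 0 = Submodule.span k {1})
    (hstd : ∀ n, 𝒜 (n + 1) = 𝒜 1 * 𝒜 n) (hfg : FiniteDimensional k (𝒜 1))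
    (hdim : ringKrullDim R = 2) {J : Ideal R} (hJ : J.IsHomogeneous 𝒜) {y : R} (hy1 : y ∈ 𝒜 1)
    (hy : y ∉ J.radical) :
    ∃ P : Ideal R, P.IsPrime ∧ J ≤ P ∧ (∃ y ∈ 𝒜 1, y ∉ P) ∧ ∃ δ, ∃ z ∈ 𝒜 δ, z ≠ 0 ∧ z ∈ P ∧
      ∃ N, ∃ s ∉ P, ∀ w ∈ P ^ N, s * w ∈ Ideal.span {z} := by
  have := noeth 𝒜 h0 hstd hfg
  obtain ⟨P, hP, hPh, hJP, hPb, y', hy1', hy'⟩ : ∃ P : Ideal R, P.IsPrime ∧ P.IsHomogeneous 𝒜 ∧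
      J ≤ P ∧ P ≠ ⊥ ∧ ∃ y ∈ 𝒜 1, y ∉ P := by
    obtain ⟨P, hP, hPh, hJP, hyP⟩ := exists_hom_prime 𝒜 hJ hy
    by_cases hPb : P = ⊥
    · have hy0 : y ≠ 0 := fun h => hyP (h ▸ P.zero_mem)
      obtain ⟨y', hy1', hy'⟩ := dim_gt 𝒜 h0 hstd hfg hdim hy1
      have hhom : (Ideal.span {y}).IsHomogeneous 𝒜 := by
        apply Ideal.homogeneous_span
        rintro x rfl
        exact ⟨1, hy1⟩
      obtain ⟨P', hP', hPh', hyP', hyP''⟩ := exists_hom_prime 𝒜 hhom hy'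
      refine ⟨P', hP', hPh', hJP.trans (hPb ▸ bot_le), fun h => ?_, y', hy1', hyP''⟩
      rw [h, Ideal.span_singleton_le_iff_mem] at hyP'
      exact hy0 hyP'
    · exact ⟨P, hP, hPh, hJP, hPb, y, hy1, hyP⟩
  obtain ⟨δ, z, hz, hzP, hz0⟩ := exists_comp 𝒜 hPh (Q := ⊥) (fun h => hPb (le_bot_iff.1 h))
  have hz0' : z ≠ 0 := hz0
  obtain ⟨Q, hQ, hPQ⟩ := exists_gt 𝒜 h0 hP hPh hy1' hy'
  refine ⟨P, hP, hJP, ⟨y', hy1', hy'⟩, δ, z, hz, hz0', hzP, prime_local ⟨⟨hP, ?_⟩, ?_⟩⟩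
  · rwa [Ideal.span_singleton_le_iff_mem]
  · rintro P1 ⟨hP1, hzP1⟩ hle
    by_contra hnle
    rw [Ideal.span_singleton_le_iff_mem] at hzP1
    refine no_chain hdim (Ideal.isPrime_bot) hP1 hP hQ (bot_lt_iff_ne_bot.2 ?_)
      (lt_of_le_not_ge hle hnle) hPQ
    rintro rfl
    exact hz0' hzP1

lemma frob_le_pow {J P : Ideal R} (h : J ≤ P) (q : ℕ) : J.frobPow q ≤ P ^ q := by
  unfold Ideal.frobPow
  rw [Ideal.span_le]
  rintro _ ⟨g, hg, rfl⟩
  exact Ideal.pow_mem_pow (h hg) q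

lemma SD_hom (I : Ideal R) (D : ℕ) : (Ideal.span (SD 𝒜 I D)).IsHomogeneous 𝒜 := by
  apply Ideal.homogeneous_span
  rintro x ⟨_, d, _, hd⟩
  exact ⟨d, hd⟩

lemma rad_of_zero [IsDomain R] (h0 : 𝒜 0 = Submodule.span k {1})
    (hstd : ∀ n, 𝒜 (n + 1) = 𝒜 1 * 𝒜 n) (hfg : FiniteDimensional k (𝒜 1))
    (hdim : ringKrullDim R = 2) (p : ℕ) [ExpChar R p] (hp : p.Prime)
    {I : Ideal R} (hI : I.IsHomogeneous 𝒜) {x : ℝ} (hx : 0 < x)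
    (hf : Tendsto (fun n : ℕ =>
          (gradedPieceDim 𝒜 (I.frobPow (p ^ n)) ⌊x * (p : ℝ) ^ n⌋₊ : ℝ) / (p : ℝ) ^ n)
        atTop (𝓝 0)) :
    ∀ y ∈ 𝒜 1, y ∈ (Ideal.span (SD 𝒜 I ⌊x⌋₊)).radical := by
  intro y hy1
  by_contra hy
  obtain ⟨P, hP, hJP, ⟨y', hy1', hy'⟩, δ, z, hz, hz0, hzP, N, s, hsP, hs⟩ :=
    exists_prime_data 𝒜 h0 hstd hfg hdim (SD_hom 𝒜 I _) hy1 hy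
  obtain ⟨M, hM⟩ := exists_nat_ge ((δ : ℝ) / x + N + 1)
  have hδ : (0 : ℝ) ≤ (δ : ℝ) / x := by positivity
  have hN0 : (0 : ℝ) ≤ N := by positivity
  have hM1 : (1 : ℝ) ≤ M := by linarith
  have hMδ : (δ : ℝ) ≤ M * x := by
    rw [← div_le_iff₀ hx]; linarith
  have hMN : N ≤ M := by
    have : (N : ℝ) ≤ M := by linarith
    exact_mod_cast this
  have hM0 : 0 < M := by
    have : (0 : ℝ) < M := by linarith
    exact_mod_cast this
  have key : ∀ n : ℕ, p ^ n / M ≤ gradedPieceDim 𝒜 (I.frobPow (p ^ n)) ⌊x * (p : ℝ) ^ n⌋₊ := by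
    intro n
    have hpn : (0 : ℝ) < (p : ℝ) ^ n := pow_pos (by exact_mod_cast hp.pos) n
    have hlt : ⌊x * (p : ℝ) ^ n⌋₊ < p ^ n * (⌊x⌋₊ + 1) := by
      rw [Nat.floor_lt (by positivity)]
      push_cast
      rw [mul_comm]
      exact mul_lt_mul_of_pos_left (Nat.lt_floor_add_one x) hpn
    rw [gpd_congr 𝒜 (fun w hw => frob_cut 𝒜 p n hI hlt hw)]
    have hML : M * (p ^ n / M) ≤ p ^ n := Nat.mul_div_le _ _
    refine many_indep 𝒜 h0 hstd hfg hP hz hz0 hzP hy1' hy' hsP hs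
      (frob_le_pow hJP _) ((Nat.mul_le_mul_right _ hMN).trans hML) ?_
    apply Nat.le_floor
    push_cast
    have hML' : (M : ℝ) * ((p ^ n / M : ℕ) : ℝ) ≤ (p : ℝ) ^ n := by exact_mod_cast hML
    have hLn : (0 : ℝ) ≤ ((p ^ n / M : ℕ) : ℝ) := by positivity
    calc ((p ^ n / M : ℕ) : ℝ) * δ ≤ ((p ^ n / M : ℕ) : ℝ) * (M * x) :=
          mul_le_mul_of_nonneg_left hMδ hLn
      _ = x * (M * ((p ^ n / M : ℕ) : ℝ)) := by ring
      _ ≤ x * (p : ℝ) ^ n := mul_le_mul_of_nonneg_left hML' hx.le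
  have hMr : (0 : ℝ) < M := by exact_mod_cast hM0
  have hev := hf.eventually (gt_mem_nhds (show (0 : ℝ) < 1 / (2 * M) by positivity))
  have hbig : ∀ᶠ n : ℕ in atTop, (2 * M : ℝ) < (p : ℝ) ^ n :=
    (tendsto_pow_atTop_atTop_of_one_lt (by exact_mod_cast hp.one_lt)).eventually_gt_atTop _
  obtain ⟨n, hn1, hn2⟩ := (hev.and hbig).exists
  have hpn : (0 : ℝ) < (p : ℝ) ^ n := pow_pos (by exact_mod_cast hp.pos) n
  rw [div_lt_iff₀ hpn] at hn1
  have h1 : ((p ^ n / M : ℕ) : ℝ) ≤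
    (gradedPieceDim 𝒜 (I.frobPow (p ^ n)) ⌊x * (p : ℝ) ^ n⌋₊ : ℝ) := by exact_mod_cast key n
  have h2 : (p : ℝ) ^ n < M * (((p ^ n / M : ℕ) : ℝ) + 1) := by
    exact_mod_cast Nat.lt_mul_div_succ (p ^ n) hM0
  have h3 : ((p ^ n / M : ℕ) : ℝ) < 1 / (2 * M) * (p : ℝ) ^ n := lt_of_le_of_lt h1 hn1
  have h4 : (M : ℝ) * ((p ^ n / M : ℕ) : ℝ) < (p : ℝ) ^ n / 2 := by
    calc (M : ℝ) * ((p ^ n / M : ℕ) : ℝ) < M * (1 / (2 * M) * (p : ℝ) ^ n) :=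
          mul_lt_mul_of_pos_left h3 hMr
      _ = (p : ℝ) ^ n / 2 := by field_simp
  linarith

end
end FThr
namespace FThr

open GradedRing

section
variable {k R : Type*} [Field k] [CommRing R] [Algebra k R]
    (𝒜 : ℕ → Submodule k R) [GradedAlgebra 𝒜]

lemma upper [IsDomain R] (h0 : 𝒜 0 = Submodule.span k {1})
    (hstd : ∀ n, 𝒜 (n + 1) = 𝒜 1 * 𝒜 n) (hfg : FiniteDimensional k (𝒜 1))
    (hdim : ringKrullDim R = 2) (p : ℕ) [ExpChar R p] (hp : p.Prime)
    {I : Ideal R} (hI : I.IsHomogeneous 𝒜) {x0 x1 x : ℝ} (hx0 : 0 < x0) (h01 : x0 < x1)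
    (h1x : x1 < x) (h1D : x1 < ⌊x0⌋₊ + 1)
    (hf0 : Tendsto (fun n : ℕ =>
          (gradedPieceDim 𝒜 (I.frobPow (p ^ n)) ⌊x0 * (p : ℝ) ^ n⌋₊ : ℝ) / (p : ℝ) ^ n)
        atTop (𝓝 0))
    (hf1 : Tendsto (fun n : ℕ =>
          (gradedPieceDim 𝒜 (I.frobPow (p ^ n)) ⌊x1 * (p : ℝ) ^ n⌋₊ : ℝ) / (p : ℝ) ^ n)
        atTop (𝓝 0)) :
    ∀ᶠ n : ℕ in atTop, ∀ w ∈ 𝒜 ⌊x * (p : ℝ) ^ n⌋₊, w ∈ I.frobPow (p ^ n) := by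
  have := noeth 𝒜 h0 hstd hfg
  have hrad := rad_of_zero 𝒜 h0 hstd hfg hdim p hp hI hx0 hf0
  obtain ⟨b, hb, u, hu, v, hv, hu0, C, hC⟩ := params 𝒜 h0 hstd hfg hdim
  obtain ⟨C', hC'⟩ := koszul_vanish 𝒜 hu hv hC
  have hbr : (0 : ℝ) < b := by exact_mod_cast hb
  have hd1 : 0 < x1 - x0 := sub_pos.2 h01
  have hd2 : 0 < x - x1 := sub_pos.2 h1x
  set D := ⌊x0⌋₊ with hD
  have hDx0 : (D : ℝ) ≤ x0 := Nat.floor_le hx0.le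
  have hev := hf1.eventually (gt_mem_nhds (show (0 : ℝ) < (x - x1) / (2 * b) by positivity))
  have hbig : Tendsto (fun n : ℕ => (p : ℝ) ^ n) atTop atTop :=
    tendsto_pow_atTop_atTop_of_one_lt (by exact_mod_cast hp.one_lt)
  filter_upwards [hev, hbig.eventually_gt_atTop (2 / (x - x1)),
    hbig.eventually_gt_atTop ((C + C' : ℝ) / (x1 - x0))] with n hn1 hn2 hn3
  have hpn : (0 : ℝ) < (p : ℝ) ^ n := pow_pos (by exact_mod_cast hp.pos) n
  rw [div_lt_iff₀ hd2] at hn2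
  rw [div_lt_iff₀ hd1] at hn3
  rw [div_lt_iff₀ hpn] at hn1
  set K := (Ideal.span (SD 𝒜 I D)).frobPow (p ^ n) with hK
  have hKI : K ≤ I.frobPow (p ^ n) := frob_mono (by
    rw [Ideal.span_le]; exact fun y hy => hy.1) _
  suffices H : ∀ w ∈ 𝒜 ⌊x * (p : ℝ) ^ n⌋₊, w ∈ K from fun w hw => hKI (H w hw)
  have hx1 : 0 < x1 := hx0.trans h01
  set m1 := ⌊x1 * (p : ℝ) ^ n⌋₊ with hm1
  set m := ⌊x * (p : ℝ) ^ n⌋₊ with hm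
  have hlt : m1 < p ^ n * (D + 1) := by
    rw [hm1, Nat.floor_lt (by positivity)]
    push_cast
    rw [mul_comm]
    exact mul_lt_mul_of_pos_left h1D hpn
  have hge : p ^ n * D + C + C' ≤ m1 := by
    apply Nat.le_floor
    push_cast
    nlinarith
  have hm1m : m1 ≤ m := Nat.floor_mono (mul_le_mul_of_nonneg_right h1x.le hpn.le)
  rw [gpd_congr 𝒜 (fun w hw => frob_cut 𝒜 p n hI hlt hw), ← hK] at hn1
  by_contra hcon
  have hKs : K = Ideal.span ((fun f => f ^ p ^ n) '' SD 𝒜 I D) := frob_span p n _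
  have hG : ∀ g ∈ (fun f => f ^ p ^ n) '' SD 𝒜 I D, ∃ d ≤ p ^ n * D, g ∈ 𝒜 d := by
    rintro _ ⟨g, ⟨_, d, hd, hgd⟩, rfl⟩
    exact ⟨p ^ n * d, Nat.mul_le_mul_left _ hd, by simpa using SetLike.pow_mem_graded (p ^ n) hgd⟩
  obtain ⟨T, hT⟩ := exists_bound 𝒜 h0 hstd hfg (J := K) (fun y hy => frob_rad _ (hrad y hy))
  set j := (m - m1) / b with hj
  have hjm : m1 + j * b ≤ m := by
    have h12 : j * b ≤ m - m1 := Nat.div_mul_le_self (m - m1) b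
    omega
  have hdec := seq_decay (fun i => gradedPieceDim 𝒜 K (m1 + i * b)) (fun i => by
      have := convex_dim 𝒜 h0 hstd hfg hu hv hu0 hC hC' hG (n := m1 + i * b)
        (hge.trans (Nat.le_add_right _ _))
      rw [← hKs] at this
      have e1 : m1 + (i + 1) * b = m1 + i * b + b := by ring
      have e2 : m1 + (i + 2) * b = m1 + i * b + b + b := by ring
      simp only [e1, e2]
      exact this) T (fun i hi => by
      rw [gpd_eq_zero_iff 𝒜 h0 hstd hfg]
      apply hT
      exact hi.le.trans ((Nat.le_mul_of_pos_right _ hb).trans (Nat.le_add_left _ _))) j (by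
      intro h
      rw [gpd_eq_zero_iff 𝒜 h0 hstd hfg] at h
      exact hcon (piece_le_mono 𝒜 hstd hjm h))
  simp only [zero_mul, add_zero] at hdec
  have h5 : m - m1 < b * (j + 1) := Nat.lt_mul_div_succ _ hb
  have h6 : m < b * (j + 1) + m1 := by omega
  have h7 : (m : ℝ) + 1 ≤ b * (j + 1) + m1 := by exact_mod_cast h6
  have h8 : x * (p : ℝ) ^ n < m + 1 := Nat.lt_floor_add_one _
  have h9 : (m1 : ℝ) ≤ x1 * (p : ℝ) ^ n := Nat.floor_le (by positivity)
  have h10 : ((j : ℝ) + 1) ≤ gradedPieceDim 𝒜 K m1 := by exact_mod_cast hdec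
  have h11 : (b : ℝ) * (j + 1) < (x - x1) * (p : ℝ) ^ n / 2 := by
    calc (b : ℝ) * (j + 1) < b * ((x - x1) / (2 * b) * (p : ℝ) ^ n) :=
          mul_lt_mul_of_pos_left (lt_of_le_of_lt h10 hn1) hbr
      _ = (x - x1) * (p : ℝ) ^ n / 2 := by field_simp
  nlinarith

end
end FThr

/-- **Theorem (Statement 1).** Let `(R, I)` be a standard graded pair over a perfect field
`k` of characteristic `p > 0`, with `R` a two-dimensional domain, and let
`f : ℝ → ℝ` be the Hilbert–Kunz density function of `(R, I)`.  Then the `F`-threshold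
`c^I(𝔪)` exists and equals `α(R, I) = sup {x ≥ 0 | f x ≠ 0}`. -/
theorem fThreshold_eq_alpha
    (p : ℕ) (hp : p.Prime)
    (k : Type*) [Field k] [CharP k p] [ExpChar k p] [PerfectRing k p]
    (R : Type*) [CommRing R] [IsDomain R] [Algebra k R]
    (𝒜 : ℕ → Submodule k R) [GradedAlgebra 𝒜]
    (h0 : 𝒜 0 = Submodule.span k {1})
    (hstd : ∀ n, 𝒜 (n + 1) = 𝒜 1 * 𝒜 n)
    (hfg : FiniteDimensional k (𝒜 1))
    (hdim : ringKrullDim R = 2)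
    (I : Ideal R) (hIhom : Ideal.IsHomogeneous 𝒜 I)
    (hcolen : FiniteDimensional k (R ⧸ I))
    -- `f` is the Hilbert–Kunz density function of `(R, I)`:
    (f : ℝ → ℝ)
    (hf : ∀ x : ℝ, 0 ≤ x →
      Tendsto (fun n : ℕ =>
          (gradedPieceDim 𝒜 (I.frobPow (p ^ n)) ⌊x * (p : ℝ) ^ n⌋₊ : ℝ) / (p : ℝ) ^ n)
        atTop (𝓝 (f x))) :
    ∃ c : ℝ,
      Tendsto (fun n : ℕ => (nuF (irrelevantIdeal 𝒜) I (p ^ n) : ℝ) / (p : ℝ) ^ n)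
        atTop (𝓝 c) ∧
      c = sSup {x : ℝ | 0 ≤ x ∧ f x ≠ 0} := by
  have hexp : ExpChar R p := expChar_of_injective_algebraMap (algebraMap k R).injective p
  refine ⟨_, ?_, rfl⟩
  set S : Set ℝ := {x : ℝ | 0 ≤ x ∧ f x ≠ 0} with hS
  obtain ⟨M, hM⟩ := FThr.big_vanish 𝒜 h0 hstd hfg hdim (FThr.colen_rad 𝒜 hIhom hcolen)
  have hpos : ∀ n : ℕ, (0 : ℝ) < (p : ℝ) ^ n := fun n => pow_pos (by exact_mod_cast hp.pos) n
  have hbig : Tendsto (fun n : ℕ => (p : ℝ) ^ n) atTop atTop :=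
    tendsto_pow_atTop_atTop_of_one_lt (by exact_mod_cast hp.one_lt)
  have hbdd : BddAbove S := by
    refine ⟨M, fun x hx => ?_⟩
    by_contra! hlt
    apply hx.2
    refine tendsto_nhds_unique (hf x hx.1) ?_
    have : (fun n : ℕ => (gradedPieceDim 𝒜 (I.frobPow (p ^ n)) ⌊x * (p : ℝ) ^ n⌋₊ : ℝ)
        / (p : ℝ) ^ n) = fun _ => 0 := by
      funext n
      rw [(FThr.gpd_eq_zero_iff 𝒜 h0 hstd hfg _ _).2]
      · simp
      · apply hM
        apply Nat.le_floor
        push_cast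
        exact mul_le_mul_of_nonneg_right hlt.le (hpos n).le
    rw [this]
    exact tendsto_const_nhds
  have hS0 : 0 ≤ sSup S := Real.sSup_nonneg fun x hx => hx.1
  have hzero : ∀ x, sSup S < x → f x = 0 := by
    intro x hx
    by_contra h
    exact absurd (le_csSup hbdd ⟨hS0.trans hx.le, h⟩) (not_le.2 hx)
  rw [tendsto_order]
  constructor
  · intro y hy
    by_cases hSne : S.Nonempty
    · obtain ⟨x, hxS, hyx⟩ := exists_lt_of_lt_csSup hSne hy
      have h1 := (hf x hxS.1).eventually_ne hxS.2
      filter_upwards [h1, hbig.eventually_gt_atTop (1 / (x - y))] with n hn hn2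
      rw [div_lt_iff₀ (sub_pos.2 hyx)] at hn2
      have hne : gradedPieceDim 𝒜 (I.frobPow (p ^ n)) ⌊x * (p : ℝ) ^ n⌋₊ ≠ 0 := by
        intro h; rw [h] at hn; simp at hn
      have hmem : nuF (irrelevantIdeal 𝒜) I (p ^ n) ∈
          {r : ℕ | irrelevantIdeal 𝒜 ^ (r + 1) ≤ I.frobPow (p ^ n)} := by
        apply Nat.sInf_mem
        refine ⟨M * p ^ n, ?_⟩
        change irrelevantIdeal 𝒜 ^ (M * p ^ n + 1) ≤ I.frobPow (p ^ n)
        rw [FThr.irr_pow_le_iff 𝒜 hstd]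
        exact hM _ _ (Nat.le_succ _)
      set ν := nuF (irrelevantIdeal 𝒜) I (p ^ n) with hν
      have hmem' : irrelevantIdeal 𝒜 ^ (ν + 1) ≤ I.frobPow (p ^ n) := hmem
      rw [FThr.irr_pow_le_iff 𝒜 hstd] at hmem'
      have hge : ⌊x * (p : ℝ) ^ n⌋₊ ≤ ν := by
        by_contra! hlt
        apply hne
        rw [FThr.gpd_eq_zero_iff 𝒜 h0 hstd hfg]
        exact FThr.piece_le_mono 𝒜 hstd hlt hmem'
      have h8 : x * (p : ℝ) ^ n < ⌊x * (p : ℝ) ^ n⌋₊ + 1 := Nat.lt_floor_add_one _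
      have h9 : ((⌊x * (p : ℝ) ^ n⌋₊ : ℕ) : ℝ) ≤ ν := by exact_mod_cast hge
      rw [lt_div_iff₀ (hpos n)]
      nlinarith
    · rw [Set.not_nonempty_iff_eq_empty.1 hSne, Real.sSup_empty] at hy
      filter_upwards with n
      exact hy.trans_le (by positivity)
  · intro y hy
    obtain ⟨x, hx, hxy⟩ := exists_between hy
    obtain ⟨x0, hx0, hx0x⟩ := exists_between hx
    obtain ⟨x1, hx01, hx1⟩ := exists_between (lt_min hx0x (Nat.lt_floor_add_one x0))
    have hpx0 : 0 < x0 := hS0.trans_lt hx0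
    have hf0 := hf x0 hpx0.le
    have hf1 := hf x1 (hpx0.trans hx01).le
    rw [hzero x0 hx0] at hf0
    rw [hzero x1 (hx0.trans hx01)] at hf1
    filter_upwards [FThr.upper 𝒜 h0 hstd hfg hdim p hp hIhom hpx0 hx01
      (hx1.trans_le (min_le_left _ _)) (hx1.trans_le (min_le_right _ _)) hf0 hf1] with n hn
    have hle : nuF (irrelevantIdeal 𝒜) I (p ^ n) ≤ ⌊x * (p : ℝ) ^ n⌋₊ := by
      apply Nat.sInf_le
      change irrelevantIdeal 𝒜 ^ (⌊x * (p : ℝ) ^ n⌋₊ + 1) ≤ I.frobPow (p ^ n)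
      rw [FThr.irr_pow_le_iff 𝒜 hstd]
      exact FThr.piece_le_mono 𝒜 hstd (Nat.le_succ _) hn
    have h9 : ((⌊x * (p : ℝ) ^ n⌋₊ : ℕ) : ℝ) ≤ x * (p : ℝ) ^ n :=
      Nat.floor_le (mul_nonneg (hpx0.trans hx0x).le (hpos n).le)
    have h10 : (nuF (irrelevantIdeal 𝒜) I (p ^ n) : ℝ) ≤ (⌊x * (p : ℝ) ^ n⌋₊ : ℕ) := by
      exact_mod_cast hle
    rw [div_lt_iff₀ (hpos n)]
    have := mul_lt_mul_of_pos_right hxy (hpos n)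
    linarith
end

section
/- Let k be a perfect field of characteristic p > 0 and let (R, I) be a standard graded pair over k such that R is a two-dimensional domain, with graded maximal ideal 𝔪. Let S be the integral closure of R in its field of fractions (the normalization of R). Then the F-thresholds c^I(𝔪) and c^{IS}(𝔪S) (of the extended ideal 𝔪S with respect to the extended ideal IS in S) both exist and c^I(𝔪) = c^{IS}(𝔪S). -/
/-!
STATEMENT 2: For a standard graded pair `(R, I)` over a perfect field of characteristic
`p > 0`, with `R` a two-dimensional domain with graded maximal ideal `𝔪`, and with `S` the
integral closure (normalization) of `R` in its fraction field, the `F`-thresholds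
`c^I(𝔪)` and `c^{IS}(𝔪S)` both exist and are equal.
-/

open Filter Topology

section FrobPow

variable {R : Type*} [CommRing R]

lemma frobPow_eq_map (p : ℕ) [ExpChar R p] (I : Ideal R) (n : ℕ) :
    I.frobPow (p ^ n) = I.map (iterateFrobenius R p n) := rfl

lemma frobPow_mono {I J : Ideal R} (h : I ≤ J) (q : ℕ) : I.frobPow q ≤ J.frobPow q :=
  Ideal.span_mono (Set.image_mono h)

lemma frobPow_le_pow (I : Ideal R) (q : ℕ) : I.frobPow q ≤ I ^ q := by
  rw [Ideal.frobPow, Ideal.span_le]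
  rintro _ ⟨f, hf, rfl⟩
  exact Ideal.pow_mem_pow hf q

lemma frobPow_frobPow (p : ℕ) [ExpChar R p] (I : Ideal R) (n m : ℕ) :
    (I.frobPow (p ^ n)).frobPow (p ^ m) = I.frobPow (p ^ (n + m)) := by
  rw [frobPow_eq_map, frobPow_eq_map, frobPow_eq_map, Ideal.map_map]
  congr 1
  ext x
  simp [iterateFrobenius_def, ← pow_mul, pow_add]

lemma map_frobPow {S : Type*} [CommRing S] (p : ℕ) [ExpChar R p] [ExpChar S p] (f : R →+* S)
    (I : Ideal R) (n : ℕ) :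
    (I.map f).frobPow (p ^ n) = (I.frobPow (p ^ n)).map f := by
  rw [frobPow_eq_map, frobPow_eq_map, Ideal.map_map, Ideal.map_map]
  congr 1
  ext x
  simp [iterateFrobenius_def]

open scoped Pointwise in
lemma pow_le_frobPow (p : ℕ) (hp : 0 < p) [ExpChar R p] (J : Ideal R) (hJ : J.FG) :
    ∃ μ : ℕ, ∀ n a : ℕ, J ^ (p ^ n * (a + μ)) ≤ (J ^ a).frobPow (p ^ n) := by
  classical
  obtain ⟨s, rfl⟩ := hJ
  refine ⟨s.card, fun n a => ?_⟩
  set q := p ^ n with hq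
  have hq0 : 0 < q := pow_pos hp n
  have hspan : Ideal.span (s : Set R) ^ (q * (a + s.card)) =
      Ideal.span ((s : Set R) ^ (q * (a + s.card))) :=
    Submodule.span_pow (R := R) (s : Set R) (q * (a + s.card))
  rw [hspan]
  rw [Ideal.span_le]
  intro x hx
  rw [Set.mem_pow] at hx
  obtain ⟨f, rfl⟩ := hx
  set d : R → ℕ := fun r => (Finset.univ.filter (fun i => (f i : R) = r)).card with hd
  have hsum : ∑ r ∈ s, d r = q * (a + s.card) := by
    simp only [hd]
    have h0 := Finset.card_eq_sum_card_fiberwise (f := fun i => (f i : R))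
      (s := Finset.univ) (t := s) (fun i _ => (f i).2)
    rw [← h0]
    simp
  have hprod : (List.ofFn fun i => (f i : R)).prod = ∏ r ∈ s, r ^ d r := by
    rw [List.prod_ofFn, ← Finset.prod_fiberwise_of_maps_to (t := s) (g := fun i => (f i : R))
      (fun i _ => (f i).2)]
    refine Finset.prod_congr rfl fun r _ => ?_
    rw [hd]
    refine Finset.prod_eq_pow_card ?_
    intro i hi
    simpa using hi
  rw [hprod]
  have hsplit : ∏ r ∈ s, r ^ d r = (∏ r ∈ s, r ^ (d r / q)) ^ q * ∏ r ∈ s, r ^ (d r % q) := by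
    rw [← Finset.prod_pow, ← Finset.prod_mul_distrib]
    refine Finset.prod_congr rfl fun r _ => ?_
    rw [← pow_mul, ← pow_add, Nat.div_add_mod']
  rw [hsplit]
  refine Ideal.mul_mem_right _ _ (Ideal.subset_span ⟨_, ?_, rfl⟩)
  have h1 : q * (a + s.card) ≤ q * ((∑ r ∈ s, d r / q) + s.card) := by
    rw [← hsum, mul_add, Finset.mul_sum, mul_comm q s.card, ← smul_eq_mul (a := s.card),
      ← Finset.sum_const, ← Finset.sum_add_distrib]
    refine Finset.sum_le_sum fun r _ => ?_
    have := Nat.div_add_mod (d r) q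
    have := Nat.mod_lt (d r) hq0
    omega
  have h2 : a ≤ ∑ r ∈ s, d r / q := by
    have := Nat.le_of_mul_le_mul_left h1 hq0
    omega
  refine Ideal.pow_le_pow_right h2 ?_
  rw [← Finset.prod_pow_eq_pow_sum]
  exact Ideal.prod_mem_prod fun r hr => Ideal.pow_mem_pow (Ideal.subset_span hr) _

end FrobPow

lemma limit_aux (p : ℕ) (hp : 2 ≤ p) (a b : ℕ → ℕ) (C e N0 : ℕ)
    (hba : ∀ n, b n ≤ a n)
    (haa : ∀ n m, a (n + m) ≤ p ^ m * (a n + C))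
    (hab : ∀ n, N0 ≤ n → a (n + e) ≤ p ^ e * (b n + C)) :
    ∃ c : ℝ, Tendsto (fun n : ℕ => (a n : ℝ) / (p : ℝ) ^ n) atTop (𝓝 c) ∧
      Tendsto (fun n : ℕ => (b n : ℝ) / (p : ℝ) ^ n) atTop (𝓝 c) := by
  have hp0 : (0 : ℝ) < p := by positivity
  have hp1 : (1 : ℝ) < p := by exact_mod_cast hp
  set u : ℕ → ℝ := fun n => (a n : ℝ) / (p : ℝ) ^ n with hu
  set v : ℕ → ℝ := fun n => (b n : ℝ) / (p : ℝ) ^ n with hv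
  have hCt : Tendsto (fun n : ℕ => (C : ℝ) / (p : ℝ) ^ n) atTop (𝓝 0) :=
    tendsto_const_nhds.div_atTop (tendsto_pow_atTop_atTop_of_one_lt hp1)
  have h1 : ∀ n m, u (n + m) ≤ u n + C / (p : ℝ) ^ n := by
    intro n m
    have : (a (n + m) : ℝ) ≤ p ^ m * (a n + C) := by exact_mod_cast haa n m
    simp only [hu]
    rw [← add_div, div_le_div_iff₀ (by positivity) (by positivity), pow_add]
    nlinarith [pow_pos hp0 n]
  have h2 : ∀ n, N0 ≤ n → u (n + e) - C / (p : ℝ) ^ n ≤ v n := by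
    intro n hn
    have : (a (n + e) : ℝ) ≤ p ^ e * (b n + C) := by exact_mod_cast hab n hn
    simp only [hu, hv]
    rw [sub_le_iff_le_add, ← add_div, div_le_div_iff₀ (by positivity) (by positivity), pow_add]
    nlinarith [pow_pos hp0 n]
  have h3 : ∀ n, v n ≤ u n := by
    intro n
    simp only [hu, hv]
    gcongr
    exact_mod_cast hba n
  have hbdd : BddBelow (Set.range (fun n => u n + C / (p : ℝ) ^ n)) := by
    refine ⟨0, ?_⟩
    rintro _ ⟨n, rfl⟩
    simp only [hu]
    positivity
  set c := ⨅ n, (u n + C / (p : ℝ) ^ n) with hc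
  have hlow : ∀ n, c ≤ u n + C / (p : ℝ) ^ n := fun n => ciInf_le hbdd n
  have hut : Tendsto u atTop (𝓝 c) := by
    rw [Metric.tendsto_atTop]
    intro ε hε
    obtain ⟨n1, hn1⟩ := exists_lt_of_ciInf_lt (show c < c + ε by linarith)
    obtain ⟨n2, hn2⟩ := (Metric.tendsto_atTop.1 hCt) ε hε
    refine ⟨max n1 n2, fun n hn => ?_⟩
    have hA := hn2 n (le_trans (le_max_right _ _) hn)
    rw [Real.dist_eq, abs_lt] at hA ⊢
    obtain ⟨m, rfl⟩ := Nat.exists_eq_add_of_le (le_trans (le_max_left _ _) hn)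
    have := h1 n1 m
    have := hlow (n1 + m)
    constructor <;> linarith
  refine ⟨c, hut, ?_⟩
  have hl : Tendsto (fun n => u (n + e) - C / (p : ℝ) ^ n) atTop (𝓝 c) := by
    simpa using ((tendsto_add_atTop_iff_nat e).2 hut).sub hCt
  refine tendsto_of_tendsto_of_tendsto_of_le_of_le' hl hut ?_ (Eventually.of_forall h3)
  filter_upwards [eventually_ge_atTop N0] with n hn using h2 n hn

lemma conductor_aux (A R : Type*) [CommRing A] [IsDomain A] [IsNoetherianRing A]
    [IsIntegrallyClosed A] [CommRing R] [IsDomain R] [Algebra A R] [FaithfulSMul A R]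
    [Module.Finite A R] (p : ℕ) [ExpChar A p] :
    ∃ N : ℕ, ∃ x : R, x ≠ 0 ∧ ∀ s : integralClosure R (FractionRing R), ∃ r : R,
      algebraMap R (integralClosure R (FractionRing R)) r =
        algebraMap R (integralClosure R (FractionRing R)) x * s ^ (p ^ N) := by
  classical
  let F := FractionRing A
  let K := FractionRing R
  let : Algebra F K := FractionRing.liftAlgebra A K
  have : IsScalarTower A F K := FractionRing.isScalarTower_liftAlgebra A K
  have : FiniteDimensional F K := by
    exact Module.Finite.of_isLocalization A R (nonZeroDivisors A)
  have : ExpChar F p := expChar_of_injective_algebraMap (IsFractionRing.injective A F) p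
  let L := separableClosure F K
  have : IsPurelyInseparable L K := separableClosure.isPurelyInseparable F K
  have : FiniteDimensional F L := inferInstance
  have : FiniteDimensional L K := inferInstance
  have : Algebra.IsSeparable F L := separableClosure.isSeparable F K
  have : ExpChar L p := expChar_of_injective_algebraMap (algebraMap F L).injective p
  have : Module.Finite A (integralClosure A L) :=
    IsIntegralClosure.finite A F L (integralClosure A L)
  have : IsScalarTower A L K := by
    refine IsScalarTower.of_algebraMap_eq fun a => ?_
    rw [IsScalarTower.algebraMap_apply A F L, ← IsScalarTower.algebraMap_apply F L K,
      ← IsScalarTower.algebraMap_apply A F K]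
  obtain ⟨G, hG⟩ := (Module.Finite.fg_top : (⊤ : Submodule A (integralClosure A L)).FG)
  let φ : integralClosure A L →ₗ[A] K :=
    (IsScalarTower.toAlgHom A L K).toLinearMap ∘ₗ (integralClosure A L).val.toLinearMap
  obtain ⟨b, hb⟩ := IsLocalization.exist_integer_multiples_of_finset (nonZeroDivisors R)
    (G.image φ)
  refine ⟨IsPurelyInseparable.exponent L K, b, nonZeroDivisors.ne_zero b.2, ?_⟩
  have hall : ∀ c : integralClosure A L, IsLocalization.IsInteger R ((b : R) • φ c) := by
    intro c
    have hc : c ∈ Submodule.span A (G : Set (integralClosure A L)) := by rw [hG]; trivial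
    induction hc using Submodule.span_induction with
    | mem x hx => exact hb _ (Finset.mem_image_of_mem _ hx)
    | zero => exact ⟨0, by simp⟩
    | add x y _ _ hx hy =>
      rw [map_add, smul_add]
      exact IsLocalization.isInteger_add hx hy
    | smul a x _ hx =>
      obtain ⟨r, hr⟩ := hx
      refine ⟨a • r, ?_⟩
      rw [LinearMap.map_smul, smul_comm, ← hr, Algebra.smul_def, Algebra.smul_def, map_mul,
        ← IsScalarTower.algebraMap_apply]
  rintro ⟨s, hs⟩
  obtain ⟨ℓ, hℓ⟩ := IsPurelyInseparable.exponent_def' L p s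
  have hsA : IsIntegral A s := isIntegral_trans (R := A) (A := R) s hs
  have hℓA : IsIntegral A ℓ := by
    rw [← isIntegral_algebraMap_iff (algebraMap L K).injective, hℓ]
    exact hsA.pow _
  obtain ⟨r, hr⟩ := hall ⟨ℓ, hℓA⟩
  refine ⟨r, Subtype.ext ?_⟩
  change algebraMap R K r = algebraMap R K b * s ^ _
  rw [hr, Algebra.smul_def]
  congr 1

lemma exists_conductor (k R : Type*) [Field k] [CommRing R] [IsDomain R] [Algebra k R]
    [Algebra.FiniteType k R] (p : ℕ) [ExpChar k p] :
    ∃ N : ℕ, ∃ x : R, x ≠ 0 ∧ ∀ s : integralClosure R (FractionRing R), ∃ r : R,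
      algebraMap R (integralClosure R (FractionRing R)) r =
        algebraMap R (integralClosure R (FractionRing R)) x * s ^ (p ^ N) := by
  obtain ⟨s, g, hg, hfin⟩ := exists_finite_inj_algHom_of_fg k R
  let : Algebra (MvPolynomial (Fin s) k) R := g.toRingHom.toAlgebra
  have : FaithfulSMul (MvPolynomial (Fin s) k) R :=
    (faithfulSMul_iff_algebraMap_injective _ _).2 hg
  have : Module.Finite (MvPolynomial (Fin s) k) R := hfin
  have : ExpChar (MvPolynomial (Fin s) k) p :=
    expChar_of_injective_algebraMap (algebraMap k _).injective p
  exact conductor_aux (MvPolynomial (Fin s) k) R p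

section Graded

set_option linter.unusedSectionVars false

open DirectSum

variable {k R : Type*} [Field k] [CommRing R] [Algebra k R]
  (𝒜 : ℕ → Submodule k R) [GradedAlgebra 𝒜]

lemma irr_eq (hstd : ∀ n, 𝒜 (n + 1) = 𝒜 1 * 𝒜 n) :
    irrelevantIdeal 𝒜 = Ideal.span (𝒜 1 : Set R) := by
  apply le_antisymm
  · rw [irrelevantIdeal, Ideal.span_le]
    intro x hx
    simp only [Set.mem_iUnion, Set.mem_Ioi] at hx
    obtain ⟨n, hn, hx⟩ := hx
    obtain ⟨m, rfl⟩ := Nat.exists_eq_succ_of_ne_zero hn.ne'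
    have hx' : x ∈ 𝒜 1 * 𝒜 m := by rw [← hstd]; exact hx
    refine Submodule.mul_induction_on hx' ?_ ?_
    · intro a ha b _
      exact Ideal.mul_mem_right _ _ (Ideal.subset_span ha)
    · intro a b ha hb
      exact Ideal.add_mem _ ha hb
  · refine Ideal.span_mono ?_
    intro x hx
    simp only [Set.mem_iUnion, Set.mem_Ioi]
    exact ⟨1, one_pos, hx⟩

lemma irr_pow (hstd : ∀ n, 𝒜 (n + 1) = 𝒜 1 * 𝒜 n) (n : ℕ) :
    irrelevantIdeal 𝒜 ^ n = Ideal.span (𝒜 n : Set R) := by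
  induction n with
  | zero =>
    rw [pow_zero, Ideal.one_eq_top, eq_comm, Ideal.eq_top_iff_one]
    exact Ideal.subset_span SetLike.GradedOne.one_mem
  | succ n ih =>
    rw [pow_succ', ih, irr_eq 𝒜 hstd, Ideal.span_mul_span']
    apply le_antisymm
    · rw [Ideal.span_le]
      rintro _ ⟨a, ha, b, hb, rfl⟩
      refine Ideal.subset_span ?_
      change a * b ∈ 𝒜 (n + 1)
      rw [hstd]
      exact Submodule.mul_mem_mul ha hb
    · rw [Ideal.span_le]
      intro x hx
      have hx' : x ∈ 𝒜 1 * 𝒜 n := by rw [← hstd]; exact hx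
      refine Submodule.mul_induction_on hx' ?_ ?_
      · intro a ha b hb
        exact Ideal.subset_span ⟨a, ha, b, hb, rfl⟩
      · intro a b ha hb
        exact Ideal.add_mem _ ha hb

lemma irr_pow_le_iff (hstd : ∀ n, 𝒜 (n + 1) = 𝒜 1 * 𝒜 n) (n : ℕ) (K : Ideal R) :
    irrelevantIdeal 𝒜 ^ n ≤ K ↔ ∀ f ∈ 𝒜 n, f ∈ K := by
  rw [irr_pow 𝒜 hstd, Ideal.span_le]
  rfl

lemma mem_irr_pow (hstd : ∀ n, 𝒜 (n + 1) = 𝒜 1 * 𝒜 n) {N n : ℕ} (h : N ≤ n) {f : R}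
    (hf : f ∈ 𝒜 n) : f ∈ irrelevantIdeal 𝒜 ^ N := by
  refine Ideal.pow_le_pow_right h ?_
  rw [irr_pow 𝒜 hstd]
  exact Ideal.subset_span hf

lemma finiteType_of_std (h0 : 𝒜 0 = Submodule.span k {1})
    (hstd : ∀ n, 𝒜 (n + 1) = 𝒜 1 * 𝒜 n) (hfg : FiniteDimensional k (𝒜 1)) :
    Algebra.FiniteType k R := by
  obtain ⟨s, hs⟩ := (Module.Finite.iff_fg.1 hfg : (𝒜 1).FG)
  refine ⟨⟨s, ?_⟩⟩
  have h1 : 𝒜 1 ≤ Subalgebra.toSubmodule (Algebra.adjoin k (s : Set R)) := by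
    rw [← hs, Submodule.span_le]
    exact Algebra.subset_adjoin
  have hn : ∀ n, 𝒜 n ≤ Subalgebra.toSubmodule (Algebra.adjoin k (s : Set R)) := by
    intro n
    induction n with
    | zero =>
      rw [h0, Submodule.span_le]
      rintro _ rfl
      exact one_mem (Algebra.adjoin k (s : Set R))
    | succ n ih =>
      rw [hstd, Submodule.mul_le]
      intro a ha b hb
      exact mul_mem (S := Subalgebra k R) (h1 ha) (ih hb)
  rw [eq_top_iff]
  intro x _
  classical
  rw [← sum_support_decompose 𝒜 x]
  exact Subalgebra.sum_mem _ fun i _ => hn i (SetLike.coe_mem _)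

lemma exists_irr_pow_le (hstd : ∀ n, 𝒜 (n + 1) = 𝒜 1 * 𝒜 n)
    (I : Ideal R) (hIhom : I.IsHomogeneous 𝒜) (hcolen : FiniteDimensional k (R ⧸ I)) :
    ∃ E, irrelevantIdeal 𝒜 ^ E ≤ I := by
  by_contra hcon
  push Not at hcon
  have h1 : ∀ n, ∃ f ∈ 𝒜 n, f ∉ I := by
    intro n
    have := hcon n
    rw [irr_pow_le_iff 𝒜 hstd] at this
    push Not at this
    exact this
  choose f hf hfI using h1
  have hli : LinearIndependent k (fun n => Ideal.Quotient.mkₐ k I (f n)) := by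
    rw [linearIndependent_iff']
    intro s g hg i hi
    by_contra hgi
    have hmem : ∑ j ∈ s, g j • f j ∈ I := by
      rw [← Ideal.Quotient.eq_zero_iff_mem, ← Ideal.Quotient.mkₐ_eq_mk k, map_sum]
      simpa using hg
    have h2 := hIhom i hmem
    have h3 : ((decompose 𝒜 (∑ j ∈ s, g j • f j)) i : R) = g i • f i := by
      rw [decompose_sum, DFinsupp.finsetSum_apply, AddSubmonoidClass.coe_finsetSum,
        Finset.sum_eq_single i]
      · exact decompose_of_mem_same 𝒜 ((𝒜 i).smul_mem _ (hf i))
      · intro j _ hj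
        exact decompose_of_mem_ne 𝒜 ((𝒜 j).smul_mem _ (hf j)) hj
      · exact fun h => absurd hi h
    rw [h3] at h2
    apply hfI i
    have h4 := Submodule.smul_of_tower_mem I (g i)⁻¹ h2
    rwa [smul_smul, inv_mul_cancel₀ hgi, one_smul] at h4
  exact not_finite_iff_infinite.2 (inferInstance : Infinite ℕ) hli.finite

/-- The subideal generated by homogeneous elements of degree at most `e`. -/
def truncIdeal (I : Ideal R) (e : ℕ) : Ideal R :=
  Ideal.span {h : R | h ∈ I ∧ ∃ i ≤ e, h ∈ 𝒜 i}

lemma truncIdeal_le (I : Ideal R) (e : ℕ) : truncIdeal 𝒜 I e ≤ I :=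
  Ideal.span_le.2 fun _ h => h.1

lemma eq_span_hom (I : Ideal R) (hI : I.IsHomogeneous 𝒜) :
    I = Ideal.span {h : R | h ∈ I ∧ ∃ i, h ∈ 𝒜 i} := by
  apply le_antisymm
  · intro x hx
    classical
    rw [← sum_support_decompose 𝒜 x]
    exact Ideal.sum_mem _ fun i _ => Ideal.subset_span ⟨hI i hx, i, SetLike.coe_mem _⟩
  · exact Ideal.span_le.2 fun _ h => h.1

lemma frobPow_span (p : ℕ) [ExpChar R p] (n : ℕ) (G : Set R) :
    (Ideal.span G).frobPow (p ^ n) = Ideal.span ((fun f => f ^ (p ^ n)) '' G) := by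
  rw [frobPow_eq_map, Ideal.map_span]
  rfl

lemma frobPow_hom (p : ℕ) [ExpChar R p] (n : ℕ) (I : Ideal R) (hI : I.IsHomogeneous 𝒜) :
    (I.frobPow (p ^ n)).IsHomogeneous 𝒜 := by
  rw [eq_span_hom 𝒜 I hI, frobPow_span]
  refine Ideal.homogeneous_span _ _ ?_
  rintro _ ⟨h, ⟨_, i, hi⟩, rfl⟩
  exact ⟨_, SetLike.pow_mem_graded (p ^ n) hi⟩

lemma truncIdeal_hom (I : Ideal R) (e : ℕ) : (truncIdeal 𝒜 I e).IsHomogeneous 𝒜 := by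
  refine Ideal.homogeneous_span _ _ ?_
  rintro h ⟨_, i, _, hi⟩
  exact ⟨i, hi⟩

/-- In degree `L`, only generators of degree at most `L / q` contribute to `I^{[q]}`. -/
lemma mem_frobPow_trunc (p : ℕ) [ExpChar R p] (hp : 0 < p) (n : ℕ) (I : Ideal R)
    (hI : I.IsHomogeneous 𝒜) {L : ℕ} {z : R} (hz : z ∈ 𝒜 L) (hzI : z ∈ I.frobPow (p ^ n)) :
    z ∈ (truncIdeal 𝒜 I (L / p ^ n)).frobPow (p ^ n) := by
  have hq : 0 < p ^ n := pow_pos hp n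
  have key : ∀ w ∈ I.frobPow (p ^ n), ∀ a : R, ((decompose 𝒜 (a * w)) L : R) ∈
      (truncIdeal 𝒜 I (L / p ^ n)).frobPow (p ^ n) := by
    intro w hw
    rw [eq_span_hom 𝒜 I hI, frobPow_span] at hw
    induction hw using Submodule.span_induction with
    | mem x hx =>
      obtain ⟨h, ⟨hhI, i, hi⟩, rfl⟩ := hx
      intro a
      have hd : h ^ p ^ n ∈ 𝒜 (p ^ n • i) := SetLike.pow_mem_graded (p ^ n) hi
      by_cases hle : p ^ n • i ≤ L
      · rw [coe_decompose_mul_of_right_mem_of_le 𝒜 hd hle]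
        refine Ideal.mul_mem_left _ _ (Ideal.subset_span ⟨h, ?_, rfl⟩)
        refine Ideal.subset_span ⟨hhI, i, ?_, hi⟩
        rw [Nat.le_div_iff_mul_le hq, mul_comm]
        exact hle
      · rw [coe_decompose_mul_of_right_mem_of_not_le 𝒜 hd hle]
        exact Ideal.zero_mem _
    | zero => intro a; simp
    | add x y _ _ hx hy =>
      intro a
      rw [mul_add, decompose_add, DirectSum.add_apply, Submodule.coe_add]
      exact Ideal.add_mem _ (hx a) (hy a)
    | smul b x _ hx =>
      intro a
      rw [smul_eq_mul, ← mul_assoc]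
      exact hx _
  have := key z hzI 1
  rwa [one_mul, decompose_of_mem_same 𝒜 hz] at this

end Graded

section Param

open DirectSum

set_option linter.unusedSectionVars false

variable {k R : Type*} [Field k] [CommRing R] [Algebra k R]
  (𝒜 : ℕ → Submodule k R) [GradedAlgebra 𝒜]

lemma minimalPrimes_hom {J P : Ideal R} (hJ : J.IsHomogeneous 𝒜) (hP : P ∈ J.minimalPrimes) :
    P.IsHomogeneous 𝒜 := by
  have hPp : P.IsPrime := hP.1.1
  have h1 : (P.homogeneousCore 𝒜).toIdeal.IsPrime := hPp.homogeneousCore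
  have h2 : J ≤ (P.homogeneousCore 𝒜).toIdeal := by
    rw [← hJ.toIdeal_homogeneousCore_eq_self]
    exact Ideal.homogeneousCore_mono 𝒜 hP.1.2
  have h3 : (P.homogeneousCore 𝒜).toIdeal = P :=
    le_antisymm (Ideal.toIdeal_homogeneousCore_le 𝒜 P)
      (hP.2 ⟨h1, h2⟩ (Ideal.toIdeal_homogeneousCore_le 𝒜 P))
  rw [← h3]
  exact (P.homogeneousCore 𝒜).isHomogeneous

lemma mem_irr_iff (f : R) : f ∈ irrelevantIdeal 𝒜 ↔ ((decompose 𝒜 f) 0 : R) = 0 := by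
  have : irrelevantIdeal 𝒜 = (HomogeneousIdeal.irrelevant 𝒜).toIdeal := by
    rw [HomogeneousIdeal.irrelevant_eq_span]
    rfl
  rw [this]
  rfl

lemma irr_ne_top [Nontrivial R] : irrelevantIdeal 𝒜 ≠ ⊤ := by
  rw [Ne, Ideal.eq_top_iff_one, mem_irr_iff,
    decompose_of_mem_same 𝒜 SetLike.GradedOne.one_mem]
  exact one_ne_zero

lemma le_irr (h0 : 𝒜 0 = Submodule.span k {1}) {P : Ideal R} (hP : P.IsHomogeneous 𝒜)
    (hPt : P ≠ ⊤) : P ≤ irrelevantIdeal 𝒜 := by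
  intro f hf
  rw [mem_irr_iff]
  have h1 : ((decompose 𝒜 f) 0 : R) ∈ P := hP 0 hf
  have h2 : ((decompose 𝒜 f) 0 : R) ∈ Submodule.span k {(1 : R)} :=
    h0.le (SetLike.coe_mem ((decompose 𝒜 f) 0))
  obtain ⟨c, hc⟩ := Submodule.mem_span_singleton.1 h2
  rw [← hc] at h1 ⊢
  by_cases hc0 : c = 0
  · rw [hc0, zero_smul]
  · exfalso
    apply hPt
    rw [Ideal.eq_top_iff_one]
    have h4 := Submodule.smul_of_tower_mem P c⁻¹ h1
    rwa [smul_smul, inv_mul_cancel₀ hc0, one_smul] at h4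

/-- Homogeneous prime avoidance. -/
lemma hom_avoid (hstd : ∀ n, 𝒜 (n + 1) = 𝒜 1 * 𝒜 n) (T : Finset (Ideal R))
    (hprime : ∀ P ∈ T, P.IsPrime) (hhom : ∀ P ∈ T, P.IsHomogeneous 𝒜)
    (hinc : ∀ P ∈ T, ∀ P' ∈ T, P' ≤ P → P' = P)
    (hirr : ∀ P ∈ T, ¬ irrelevantIdeal 𝒜 ≤ P) :
    ∃ t, 0 < t ∧ ∃ y ∈ 𝒜 t, ∀ P ∈ T, y ∉ P := by
  classical
  have hz : ∀ P ∈ T, ∃ t, 0 < t ∧ ∃ z ∈ 𝒜 t, z ∉ P ∧ ∀ P' ∈ T, P' ≠ P → z ∈ P' := by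
    intro P hP
    have := hprime P hP
    have hw : ∀ P' ∈ T.erase P, ∃ i, ∃ w ∈ 𝒜 i, w ∈ P' ∧ w ∉ P := by
      intro P' hP'
      rw [Finset.mem_erase] at hP'
      by_contra hcon
      push Not at hcon
      apply hP'.1
      refine hinc P hP P' hP'.2 ?_
      rw [eq_span_hom 𝒜 P' (hhom P' hP'.2), Ideal.span_le]
      rintro h ⟨hh, i, hi⟩
      exact hcon i h hi hh
    choose! i w hwi hwP' hwP using hw
    have h1 : ∃ w0 ∈ 𝒜 1, w0 ∉ P := by
      by_contra hcon
      push Not at hcon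
      apply hirr P hP
      rw [irr_eq 𝒜 hstd, Ideal.span_le]
      exact hcon
    obtain ⟨w0, hw0, hw0P⟩ := h1
    refine ⟨1 + ∑ P' ∈ T.erase P, i P', by omega, w0 * ∏ P' ∈ T.erase P, w P', ?_, ?_, ?_⟩
    · exact SetLike.mul_mem_graded hw0 (SetLike.prod_mem_graded 𝒜 i w hwi)
    · intro hmem
      rcases this.mem_or_mem hmem with h | h
      · exact hw0P h
      · obtain ⟨P', hP', h⟩ := this.prod_mem_iff.1 h
        exact hwP P' hP' h
    · intro P' hP' hne
      refine Ideal.mul_mem_left _ _ ?_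
      have hmem : P' ∈ T.erase P := Finset.mem_erase.2 ⟨hne, hP'⟩
      exact Ideal.mem_of_dvd _ (Finset.dvd_prod_of_mem w hmem) (hwP' P' hmem)
  choose! t ht z hzt hzP hzP' using hz
  refine ⟨∏ P ∈ T, t P, Finset.prod_pos ht, ∑ P ∈ T, z P ^ ((∏ P ∈ T, t P) / t P), ?_, ?_⟩
  · refine Submodule.sum_mem _ fun P hP => ?_
    have h1 := SetLike.pow_mem_graded ((∏ P ∈ T, t P) / t P) (hzt P hP)
    rwa [smul_eq_mul, Nat.div_mul_cancel (Finset.dvd_prod_of_mem t hP)] at h1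
  · intro P hP hmem
    have := hprime P hP
    have hpos : ∀ P ∈ T, (∏ P ∈ T, t P) / t P ≠ 0 := by
      intro P hP
      have := Nat.div_pos (Nat.le_of_dvd (Finset.prod_pos ht) (Finset.dvd_prod_of_mem t hP))
        (ht P hP)
      omega
    rw [← Finset.add_sum_erase _ _ hP] at hmem
    have h2 : ∑ Q ∈ T.erase P, z Q ^ ((∏ P ∈ T, t P) / t Q) ∈ P := by
      refine Ideal.sum_mem _ fun Q hQ => ?_
      rw [Finset.mem_erase] at hQ
      exact Ideal.pow_mem_of_mem _ (hzP' Q hQ.2 P hP hQ.1.symm) _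
        (Nat.pos_of_ne_zero (hpos Q hQ.2))
    have h3 := (Ideal.add_mem_iff_left P h2).1 hmem
    exact hzP P hP (this.mem_of_pow_mem _ h3)

lemma exists_param [IsDomain R] [IsNoetherianRing R] (h0 : 𝒜 0 = Submodule.span k {1})
    (hstd : ∀ n, 𝒜 (n + 1) = 𝒜 1 * 𝒜 n) (hdim : ringKrullDim R = 2)
    {x : R} {d : ℕ} (hx : x ∈ 𝒜 d) (hx0 : x ≠ 0) :
    ∃ t, 0 < t ∧ ∃ y ∈ 𝒜 t, ∃ c, irrelevantIdeal 𝒜 ^ c ≤ Ideal.span {x, y} := by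
  classical
  have hxhom : (Ideal.span {x}).IsHomogeneous 𝒜 := by
    refine Ideal.homogeneous_span _ _ ?_
    rintro _ rfl
    exact ⟨d, hx⟩
  have hfin := (Ideal.finite_minimalPrimes_of_isNoetherianRing R (Ideal.span {x}))
  set T : Finset (Ideal R) := hfin.toFinset.filter (fun P => ¬ irrelevantIdeal 𝒜 ≤ P) with hT
  have hTm : ∀ P, P ∈ T ↔ P ∈ (Ideal.span {x}).minimalPrimes ∧ ¬ irrelevantIdeal 𝒜 ≤ P := by
    intro P
    simp [hT]
  obtain ⟨t, ht, y, hy, hyT⟩ := hom_avoid 𝒜 hstd T (fun P hP => ((hTm P).1 hP).1.1.1)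
    (fun P hP => minimalPrimes_hom 𝒜 hxhom ((hTm P).1 hP).1)
    (fun P hP P' hP' hle => le_antisymm hle (((hTm P).1 hP).1.2 ((hTm P').1 hP').1.1 hle))
    (fun P hP => ((hTm P).1 hP).2)
  refine ⟨t, ht, y, hy, ?_⟩
  refine Ideal.exists_pow_le_of_le_radical_of_fg ?_ (IsNoetherian.noetherian _)
  rw [Ideal.radical_eq_sInf]
  refine le_sInf ?_
  rintro Q ⟨hQ, hQp⟩
  obtain ⟨P, hP, hPQ⟩ := Ideal.exists_minimalPrimes_le hQ
  refine le_trans ?_ hPQ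
  have hxyhom : (Ideal.span {x, y}).IsHomogeneous 𝒜 := by
    refine Ideal.homogeneous_span _ _ ?_
    rintro _ (rfl | rfl)
    · exact ⟨d, hx⟩
    · exact ⟨t, hy⟩
  have hPp : P.IsPrime := hP.1.1
  have hPhom := minimalPrimes_hom 𝒜 hxyhom hP
  have hPle := le_irr 𝒜 h0 hPhom hPp.ne_top
  have hyP : y ∈ P := hP.1.2 (Ideal.subset_span (by simp))
  have hxP : x ∈ P := hP.1.2 (Ideal.subset_span (by simp))
  obtain ⟨P1, hP1, hP1P⟩ := Ideal.exists_minimalPrimes_le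
    (show Ideal.span {x} ≤ P by rwa [Ideal.span_singleton_le_iff_mem])
  by_cases hm : irrelevantIdeal 𝒜 ≤ P1
  · exact hm.trans hP1P
  by_contra hcon
  have hP1p : P1.IsPrime := hP1.1.1
  have hyP1 := hyT P1 ((hTm P1).2 ⟨hP1, hm⟩)
  obtain ⟨M, hM, hmM⟩ := Ideal.exists_le_maximal _ (irr_ne_top 𝒜)
  have hMp : M.IsPrime := hM.isPrime
  have l1 : (⊥ : Ideal R) < P1 := by
    rw [bot_lt_iff_ne_bot]
    rintro rfl
    have : x ∈ (⊥ : Ideal R) := hP1.1.2 (Ideal.mem_span_singleton_self x)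
    exact hx0 this
  have l2 : P1 < P := lt_of_le_of_ne hP1P (by rintro rfl; exact hyP1 hyP)
  have l3 : P < M := lt_of_le_of_ne (hPle.trans hmM) (by rintro rfl; exact hcon hmM)
  have hb : (⊥ : Ideal R).IsPrime := Ideal.isPrime_bot
  have e1 := Ideal.height_add_one_le_of_lt_of_isPrime l1
  have e2 := Ideal.height_add_one_le_of_lt_of_isPrime l2
  have e3 := Ideal.height_add_one_le_of_lt_of_isPrime l3
  have e4 := Ideal.height_le_ringKrullDim_of_ne_top hM.ne_top
  rw [hdim] at e4
  have e5 : M.height ≤ 2 := WithBot.coe_le_coe.1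
    (show ((M.height : ℕ∞) : WithBot ℕ∞) ≤ ((2 : ℕ∞) : WithBot ℕ∞) from e4)
  have e6 : (3 : ℕ∞) ≤ M.height := by
    calc (3 : ℕ∞) = 0 + 1 + 1 + 1 := by norm_num
      _ ≤ (⊥ : Ideal R).height + 1 + 1 + 1 := by gcongr; exact bot_le
      _ ≤ P1.height + 1 + 1 := by gcongr
      _ ≤ P.height + 1 := by gcongr
      _ ≤ M.height := e3
  have e7 : (3 : ℕ∞) ≤ 2 := e6.trans e5
  exact absurd e7 (by decide)

end Param

section L4

open DirectSum

set_option linter.unusedSectionVars false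

variable {k R : Type*} [Field k] [CommRing R] [Algebra k R]
  (𝒜 : ℕ → Submodule k R) [GradedAlgebra 𝒜]

lemma span_single_hom {x : R} {d : ℕ} (hx : x ∈ 𝒜 d) : (Ideal.span {x}).IsHomogeneous 𝒜 := by
  refine Ideal.homogeneous_span _ _ ?_
  rintro _ rfl
  exact ⟨d, hx⟩

lemma param_surj (hstd : ∀ n, 𝒜 (n + 1) = 𝒜 1 * 𝒜 n) {x y : R} {d t c0 : ℕ} (hx : x ∈ 𝒜 d)
    (hy : y ∈ 𝒜 t) (hc : irrelevantIdeal 𝒜 ^ c0 ≤ Ideal.span {x, y}) {m : ℕ} (hm : c0 ≤ m)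
    {f : R} (hf : f ∈ 𝒜 (m + t)) : ∃ g ∈ 𝒜 m, f - y * g ∈ Ideal.span {x} := by
  have h1 := hc (mem_irr_pow 𝒜 hstd (by omega : c0 ≤ m + t) hf)
  obtain ⟨a, b, hab⟩ := Ideal.mem_span_pair.1 h1
  refine ⟨(decompose 𝒜 b) m, SetLike.coe_mem _, ?_⟩
  have h2 : ((decompose 𝒜 (b * y)) (m + t) : R) = (decompose 𝒜 b) m * y :=
    coe_decompose_mul_add_of_right_mem 𝒜 hy
  have h3 : ((decompose 𝒜 (a * x)) (m + t) : R) ∈ Ideal.span {x} :=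
    span_single_hom 𝒜 hx _ (Ideal.mul_mem_left _ _ (Ideal.mem_span_singleton_self x))
  have h4 : f = (decompose 𝒜 (a * x)) (m + t) + (decompose 𝒜 (b * y)) (m + t) := by
    rw [← decompose_of_mem_same 𝒜 hf, ← hab, decompose_add]
    simp
  rw [h2] at h4
  have h5 : f - y * (decompose 𝒜 b) m = (decompose 𝒜 (a * x)) (m + t) := by
    linear_combination h4
  rw [h5]
  exact h3

lemma param_surj_pow (hstd : ∀ n, 𝒜 (n + 1) = 𝒜 1 * 𝒜 n) {x y : R} {d t c0 : ℕ} (hx : x ∈ 𝒜 d)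
    (hy : y ∈ 𝒜 t) (hc : irrelevantIdeal 𝒜 ^ c0 ≤ Ideal.span {x, y}) {m : ℕ} (hm : c0 ≤ m)
    (T : ℕ) : ∀ f ∈ 𝒜 (m + T * t), ∃ g ∈ 𝒜 m, f - y ^ T * g ∈ Ideal.span {x} := by
  induction T with
  | zero =>
    intro f hf
    refine ⟨f, by simpa using hf, by simp⟩
  | succ T ih =>
    intro f hf
    rw [add_mul, one_mul, ← add_assoc] at hf
    obtain ⟨g1, hg1, h1⟩ := param_surj 𝒜 hstd hx hy hc (by omega : c0 ≤ m + T * t) hf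
    obtain ⟨g, hg, h2⟩ := ih g1 hg1
    refine ⟨g, hg, ?_⟩
    have : f - y ^ (T + 1) * g = (f - y * g1) + y * (g1 - y ^ T * g) := by ring
    rw [this]
    exact Ideal.add_mem _ h1 (Ideal.mul_mem_left _ _ h2)

lemma param_cancel [IsNoetherianRing R] (hstd : ∀ n, 𝒜 (n + 1) = 𝒜 1 * 𝒜 n) {x y : R}
    {d t c0 : ℕ} (hx : x ∈ 𝒜 d)
    (hy : y ∈ 𝒜 t) (hc : irrelevantIdeal 𝒜 ^ c0 ≤ Ideal.span {x, y}) :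
    ∃ c1, c0 ≤ c1 ∧ ∀ m, c1 ≤ m → ∀ f ∈ 𝒜 m, ∀ N, y ^ N * f ∈ Ideal.span {x} →
      f ∈ Ideal.span {x} := by
  let K : ℕ →o Ideal R :=
    { toFun := fun N => Submodule.comap (LinearMap.mulLeft R (y ^ N)) (Ideal.span {x})
      monotone' := by
        intro a b hab f hf
        obtain ⟨c, rfl⟩ := Nat.exists_eq_add_of_le hab
        have hf' : y ^ a * f ∈ Ideal.span {x} := hf
        change y ^ (a + c) * f ∈ Ideal.span {x}
        rw [pow_add, mul_comm (y ^ a), mul_assoc]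
        exact Ideal.mul_mem_left _ _ hf' }
  obtain ⟨N0, hN0⟩ := monotone_stabilizes_iff_noetherian.2 ‹IsNoetherianRing R› K
  have hK : ∀ N f, y ^ (N + N0) * f ∈ Ideal.span {x} → y ^ N0 * f ∈ Ideal.span {x} := by
    intro N f hf
    have h1 : f ∈ K (N + N0) := hf
    rw [← hN0 (N + N0) (by omega)] at h1
    exact h1
  refine ⟨c0 + N0 * t, by omega, ?_⟩
  intro m hm f hf N hN
  obtain ⟨m', rfl⟩ := Nat.exists_eq_add_of_le hm
  have e : c0 + N0 * t + m' = (c0 + m') + N0 * t := by ring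
  rw [e] at hf
  obtain ⟨g, hg, h1⟩ := param_surj_pow 𝒜 hstd hx hy hc (by omega : c0 ≤ c0 + m') N0 f hf
  have h2 : y ^ (N + N0) * g ∈ Ideal.span {x} := by
    have : y ^ (N + N0) * g = y ^ N * f - y ^ N * (f - y ^ N0 * g) := by ring
    rw [this]
    exact Ideal.sub_mem _ hN (Ideal.mul_mem_left _ _ h1)
  have h3 := Ideal.add_mem _ h1 (hK N g h2)
  simpa using h3

/-- Step (d). -/
lemma param_lift [IsNoetherianRing R] (hstd : ∀ n, 𝒜 (n + 1) = 𝒜 1 * 𝒜 n) (p : ℕ) [ExpChar R p]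
    (hp : 0 < p) {x y : R}
    {d t c0 c1 : ℕ} (ht : 0 < t) (hx : x ∈ 𝒜 d) (hy : y ∈ 𝒜 t)
    (hc : irrelevantIdeal 𝒜 ^ c0 ≤ Ideal.span {x, y}) (hc01 : c0 ≤ c1)
    (hc1 : ∀ m, c1 ≤ m → ∀ f ∈ 𝒜 m, ∀ N, y ^ N * f ∈ Ideal.span {x} → f ∈ Ideal.span {x})
    (I : Ideal R) (e M n : ℕ)
    (hM : irrelevantIdeal 𝒜 ^ M ≤ truncIdeal 𝒜 I e ⊔ Ideal.span {x})
    {N : ℕ} (hN : p ^ n * e + c1 ≤ N) {f : R} (hf : f ∈ 𝒜 N) :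
    ∃ w ∈ (truncIdeal 𝒜 I e).frobPow (p ^ n), w ∈ 𝒜 N ∧ f - w ∈ Ideal.span {x} := by
  set q := p ^ n with hq
  have hqpos : 0 < q := pow_pos hp n
  set T := M * q with hT
  have hyM : y ^ M ∈ truncIdeal 𝒜 I e ⊔ Ideal.span {x} := by
    refine hM (mem_irr_pow 𝒜 hstd (n := M • t) ?_ (SetLike.pow_mem_graded M hy))
    rw [smul_eq_mul]
    exact Nat.le_mul_of_pos_right M ht
  obtain ⟨j, hj, r, hr, hjr⟩ := Submodule.mem_sup.1 hyM
  have hyT : y ^ T - j ^ q ∈ Ideal.span {x} := by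
    have : y ^ T = j ^ q + r ^ q := by
      rw [hT, pow_mul, ← hjr, hq, add_pow_expChar_pow]
    rw [this, add_sub_cancel_left]
    exact Ideal.pow_mem_of_mem _ hr _ hqpos
  have key : ∀ z ∈ (truncIdeal 𝒜 I e).frobPow q, ∀ a : R,
      ∃ w ∈ (truncIdeal 𝒜 I e).frobPow q, w ∈ 𝒜 N ∧
        ((decompose 𝒜 (a * z)) (N + T * t) : R) - y ^ T * w ∈ Ideal.span {x} := by
    intro z hz
    have hz' := hz
    rw [hq, truncIdeal, frobPow_span] at hz'
    refine Submodule.span_induction (p := fun z _ => ∀ a : R,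
      ∃ w ∈ (truncIdeal 𝒜 I e).frobPow q, w ∈ 𝒜 N ∧
        ((decompose 𝒜 (a * z)) (N + T * t) : R) - y ^ T * w ∈ Ideal.span {x})
        ?_ ?_ ?_ ?_ hz'
    · rintro _ ⟨h, ⟨hI, i, hi, hh⟩, rfl⟩ a
      have hhq : h ^ q ∈ 𝒜 (q * i) := SetLike.pow_mem_graded q hh
      have hqi : q * i ≤ q * e := Nat.mul_le_mul_left q hi
      obtain ⟨s, hs⟩ := Nat.exists_eq_add_of_le (by omega : q * i + c0 ≤ N)
      have e1 : N + T * t = (c0 + s + T * t) + q * i := by rw [hs]; ring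
      have e2 : ((decompose 𝒜 (a * h ^ q)) (N + T * t) : R) =
          (decompose 𝒜 a) (c0 + s + T * t) * h ^ q := by
        rw [e1]
        exact coe_decompose_mul_add_of_right_mem 𝒜 hhq
      obtain ⟨g, hg, h1⟩ := param_surj_pow 𝒜 hstd hx hy hc (by omega : c0 ≤ c0 + s) T
        ((decompose 𝒜 a) (c0 + s + T * t)) (SetLike.coe_mem _)
      refine ⟨g * h ^ q, ?_, ?_, ?_⟩
      · exact Ideal.mul_mem_left _ _
          (Ideal.subset_span ⟨h, Ideal.subset_span ⟨hI, i, hi, hh⟩, rfl⟩)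
      · have e3 : N = (c0 + s) + q * i := by rw [hs]; ring
        rw [e3]
        exact SetLike.mul_mem_graded hg hhq
      · change ((decompose 𝒜 (a * h ^ q)) (N + T * t) : R) - y ^ T * (g * h ^ q) ∈ _
        rw [e2, ← mul_assoc, ← sub_mul]
        exact Ideal.mul_mem_right _ _ h1
    · intro a
      exact ⟨0, Ideal.zero_mem _, Submodule.zero_mem _, by simp⟩
    · intro u v _ _ hu hv a
      obtain ⟨w1, h1, h2, h3⟩ := hu a
      obtain ⟨w2, h4, h5, h6⟩ := hv a
      refine ⟨w1 + w2, Ideal.add_mem _ h1 h4, Submodule.add_mem _ h2 h5, ?_⟩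
      have : ((decompose 𝒜 (a * (u + v))) (N + T * t) : R) - y ^ T * (w1 + w2) =
          (((decompose 𝒜 (a * u)) (N + T * t) : R) - y ^ T * w1) +
          (((decompose 𝒜 (a * v)) (N + T * t) : R) - y ^ T * w2) := by
        rw [mul_add, decompose_add, DirectSum.add_apply, Submodule.coe_add]
        ring
      rw [this]
      exact Ideal.add_mem _ h3 h6
    · intro b z _ hz a
      obtain ⟨w, h1, h2, h3⟩ := hz (a * b)
      refine ⟨w, h1, h2, ?_⟩
      rwa [smul_eq_mul, ← mul_assoc]
  obtain ⟨w, hw, hwN, h1⟩ := key (j ^ q) (Ideal.subset_span ⟨j, hj, rfl⟩) f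
  refine ⟨w, hw, hwN, ?_⟩
  refine hc1 N (by omega) _ (Submodule.sub_mem _ hf hwN) T ?_
  have hyTf : f * y ^ T ∈ 𝒜 (N + T * t) :=
    SetLike.mul_mem_graded hf (SetLike.pow_mem_graded T hy)
  have h2 : ((decompose 𝒜 (f * (y ^ T - j ^ q))) (N + T * t) : R) ∈ Ideal.span {x} :=
    span_single_hom 𝒜 hx _ (Ideal.mul_mem_left _ _ hyT)
  have h3 : ((decompose 𝒜 (f * (y ^ T - j ^ q))) (N + T * t) : R) =
      f * y ^ T - (decompose 𝒜 (f * j ^ q)) (N + T * t) := by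
    rw [mul_sub, decompose_sub, DirectSum.sub_apply, Submodule.coe_sub, decompose_of_mem_same 𝒜 hyTf]
  rw [h3] at h2
  have h4 : y ^ T * (f - w) = (f * y ^ T - (decompose 𝒜 (f * j ^ q)) (N + T * t)) +
    (((decompose 𝒜 (f * j ^ q)) (N + T * t) : R) - y ^ T * w) := by ring
  rw [h4]
  exact Ideal.add_mem _ h2 h1

lemma krull_aux [IsDomain R] [IsNoetherianRing R] {x : R} (hx0 : x ≠ 0) (P : Ideal R)
    (hP : P.IsPrime) : ∃ Q : ℕ, ∀ s ∉ P, x * s ∉ P ^ Q := by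
  by_contra hcon
  push Not at hcon
  have h1 : algebraMap R (Localization.AtPrime P) x ∈
      ⨅ i : ℕ, IsLocalRing.maximalIdeal (Localization.AtPrime P) ^ i := by
    rw [Ideal.mem_iInf]
    intro i
    obtain ⟨s, hs, hxs⟩ := hcon i
    have h2 := Ideal.mem_map_of_mem (algebraMap R (Localization.AtPrime P)) hxs
    rw [Ideal.map_pow, Localization.AtPrime.map_eq_maximalIdeal, map_mul] at h2
    have hu : IsUnit (algebraMap R (Localization.AtPrime P) s) :=
      IsLocalization.map_units (Localization.AtPrime P) (⟨s, hs⟩ : P.primeCompl)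
    exact (Ideal.mul_unit_mem_iff_mem _ hu).1 h2
  have : IsNoetherianRing (Localization.AtPrime P) :=
    IsLocalization.isNoetherianRing P.primeCompl _ inferInstance
  rw [Ideal.iInf_pow_eq_bot_of_isLocalRing _ (IsLocalRing.maximalIdeal.isMaximal _).ne_top] at h1
  apply hx0
  apply IsLocalization.injective (Localization.AtPrime P) P.primeCompl_le_nonZeroDivisors
  rw [map_zero]
  exact h1

lemma exists_M [IsDomain R] [IsNoetherianRing R] (hstd : ∀ n, 𝒜 (n + 1) = 𝒜 1 * 𝒜 n) (p : ℕ)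
    (hp : 2 ≤ p) {x : R} (hx0 : x ≠ 0) (J : Ideal R) :
    ∃ Q : ℕ, ∀ n, Q ≤ n → ∀ N1, (∀ g ∈ 𝒜 N1, x * g ∈ J.frobPow (p ^ n)) →
      ∃ M, irrelevantIdeal 𝒜 ^ M ≤ J ⊔ Ideal.span {x} := by
  by_cases hM : irrelevantIdeal 𝒜 ≤ (J ⊔ Ideal.span {x}).radical
  · obtain ⟨M, hM⟩ := Ideal.exists_pow_le_of_le_radical_of_fg hM (IsNoetherian.noetherian _)
    exact ⟨0, fun _ _ _ _ => ⟨M, hM⟩⟩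
  rw [Ideal.radical_eq_sInf, le_sInf_iff] at hM
  push Not at hM
  obtain ⟨P, ⟨hJP, hP⟩, hmP⟩ := hM
  obtain ⟨Q, hQ⟩ := krull_aux hx0 P hP
  rw [irr_eq 𝒜 hstd, Ideal.span_le, Set.not_subset] at hmP
  obtain ⟨z, hz, hzP⟩ := hmP
  refine ⟨Q, fun n hn N1 h => ?_⟩
  exfalso
  have hz1 : z ^ N1 ∈ 𝒜 N1 := by
    have := SetLike.pow_mem_graded N1 hz
    rwa [smul_eq_mul, mul_one] at this
  refine hQ (z ^ N1) (fun hh => hzP (hP.mem_of_pow_mem _ hh)) ?_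
  have h1 := frobPow_le_pow P _ (frobPow_mono (le_sup_left.trans hJP) _ (h _ hz1))
  exact Ideal.pow_le_pow_right (hn.trans (Nat.lt_pow_self (by omega)).le) h1

lemma L4_hom [IsDomain R] [IsNoetherianRing R] (h0 : 𝒜 0 = Submodule.span k {1})
    (hstd : ∀ n, 𝒜 (n + 1) = 𝒜 1 * 𝒜 n) (hdim : ringKrullDim R = 2) (p : ℕ) [ExpChar R p]
    (hp : 2 ≤ p) (I : Ideal R) (hI : I.IsHomogeneous 𝒜) (E : ℕ) (hE : irrelevantIdeal 𝒜 ^ E ≤ I)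
    {x : R} {d : ℕ} (hx : x ∈ 𝒜 d) (hx0 : x ≠ 0) :
    ∃ C n1, ∀ n, n1 ≤ n → ∀ N1, (∀ g ∈ 𝒜 N1, x * g ∈ I.frobPow (p ^ n)) →
      irrelevantIdeal 𝒜 ^ (N1 + C) ≤ I.frobPow (p ^ n) := by
  obtain ⟨t, ht, y, hy, c0, hc⟩ := exists_param 𝒜 h0 hstd hdim hx hx0
  obtain ⟨c1, hc01, hc1⟩ := param_cancel 𝒜 hstd hx hy hc
  choose Q hQ using fun e => exists_M 𝒜 hstd p hp hx0 (truncIdeal 𝒜 I e)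
  refine ⟨d + c1, ∑ e ∈ Finset.range E, Q e, fun n hn N1 h => ?_⟩
  set e := (d + N1) / p ^ n with he
  have hMe : ∃ M, irrelevantIdeal 𝒜 ^ M ≤ truncIdeal 𝒜 I e ⊔ Ideal.span {x} := by
    by_cases heE : e < E
    · refine hQ e n ?_ N1 ?_
      · exact (Finset.single_le_sum (f := Q) (fun _ _ => Nat.zero_le _)
          (Finset.mem_range.2 heE)).trans hn
      · intro g hg
        exact mem_frobPow_trunc 𝒜 p (by omega) n I hI (SetLike.mul_mem_graded hx hg) (h g hg)
    · refine ⟨E, le_sup_of_le_left ?_⟩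
      rw [irr_pow_le_iff 𝒜 hstd]
      intro f hf
      exact Ideal.subset_span ⟨hE (mem_irr_pow 𝒜 hstd le_rfl hf), E, by omega, hf⟩
  obtain ⟨M, hM⟩ := hMe
  rw [irr_pow_le_iff 𝒜 hstd]
  intro f hf
  have hqe : p ^ n * e ≤ d + N1 := Nat.mul_div_le _ _
  obtain ⟨w, hw, hwN, h1⟩ := param_lift 𝒜 hstd p (by omega) ht hx hy hc hc01 hc1 I e M n hM
    (by omega : p ^ n * e + c1 ≤ N1 + (d + c1)) hf
  obtain ⟨b, hb⟩ := Ideal.mem_span_singleton.1 h1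
  have e1 : N1 + (d + c1) = d + (N1 + c1) := by ring
  have h2 : f - w = x * (decompose 𝒜 b) (N1 + c1) := by
    have h3 : f - w ∈ 𝒜 (d + (N1 + c1)) := by
      rw [← e1]
      exact Submodule.sub_mem _ hf hwN
    rw [← decompose_of_mem_same 𝒜 h3, hb]
    exact coe_decompose_mul_add_of_left_mem 𝒜 hx
  have h4 : ∀ g ∈ irrelevantIdeal 𝒜 ^ N1, x * g ∈ I.frobPow (p ^ n) := by
    have : irrelevantIdeal 𝒜 ^ N1 ≤
        Submodule.comap (LinearMap.mulLeft R x) (I.frobPow (p ^ n)) := by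
      rw [irr_pow_le_iff 𝒜 hstd]
      exact h
    exact fun g hg => this hg
  have h5 : f - w ∈ I.frobPow (p ^ n) := by
    rw [h2]
    exact h4 _ (mem_irr_pow 𝒜 hstd (by omega : N1 ≤ N1 + c1) (SetLike.coe_mem _))
  have h6 := Ideal.add_mem _ h5 (frobPow_mono (truncIdeal_le 𝒜 I e) _ hw)
  simpa using h6

lemma L4 [IsDomain R] [IsNoetherianRing R] (h0 : 𝒜 0 = Submodule.span k {1})
    (hstd : ∀ n, 𝒜 (n + 1) = 𝒜 1 * 𝒜 n) (hdim : ringKrullDim R = 2) (p : ℕ) [ExpChar R p]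
    (hp : 2 ≤ p) (I : Ideal R) (hI : I.IsHomogeneous 𝒜) (E : ℕ) (hE : irrelevantIdeal 𝒜 ^ E ≤ I)
    {x : R} (hx0 : x ≠ 0) :
    ∃ C n1, ∀ n, n1 ≤ n → ∀ N1, (∀ g ∈ irrelevantIdeal 𝒜 ^ N1, x * g ∈ I.frobPow (p ^ n)) →
      irrelevantIdeal 𝒜 ^ (N1 + C) ≤ I.frobPow (p ^ n) := by
  have hd : ∃ d, ((decompose 𝒜 x) d : R) ≠ 0 := by
    by_contra hcon
    push Not at hcon
    apply hx0
    classical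
    rw [← sum_support_decompose 𝒜 x]
    exact Finset.sum_eq_zero fun i _ => hcon i
  obtain ⟨d, hd⟩ := hd
  obtain ⟨C, n1, h⟩ := L4_hom 𝒜 h0 hstd hdim p hp I hI E hE (SetLike.coe_mem _) hd
  refine ⟨C, n1, fun n hn N1 hN1 => h n hn N1 fun g hg => ?_⟩
  rw [← coe_decompose_mul_add_of_right_mem 𝒜 hg]
  exact frobPow_hom 𝒜 p n I hI _ (hN1 g (mem_irr_pow 𝒜 hstd le_rfl hg))

end L4

lemma conductor_step {R S : Type*} [CommRing R] [CommRing S] [Algebra R S] (p : ℕ) [ExpChar R p]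
    [ExpChar S p] (N : ℕ) (x : R)
    (hx : ∀ s : S, ∃ r : R, algebraMap R S r = algebraMap R S x * s ^ (p ^ N))
    (K : Ideal R) {z : S} (hz : z ∈ K.map (algebraMap R S)) :
    ∃ r ∈ K.frobPow (p ^ N), algebraMap R S r = algebraMap R S x * z ^ (p ^ N) := by
  have key : ∀ a : S, ∃ r ∈ K.frobPow (p ^ N),
      algebraMap R S r = algebraMap R S x * (a * z) ^ (p ^ N) := by
    refine Submodule.span_induction (p := fun z _ => ∀ a : S, ∃ r ∈ K.frobPow (p ^ N),
      algebraMap R S r = algebraMap R S x * (a * z) ^ (p ^ N)) ?_ ?_ ?_ ?_ hz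
    · rintro _ ⟨h, hh, rfl⟩ a
      obtain ⟨r0, hr0⟩ := hx a
      refine ⟨r0 * h ^ (p ^ N), Ideal.mul_mem_left _ _ (Ideal.subset_span ⟨h, hh, rfl⟩), ?_⟩
      rw [map_mul, hr0, map_pow]
      ring
    · intro a
      refine ⟨0, Ideal.zero_mem _, ?_⟩
      rw [mul_zero, zero_pow (pow_ne_zero N (expChar_ne_zero S p)), mul_zero, map_zero]
    · intro u v _ _ hu hv a
      obtain ⟨r1, h1, h2⟩ := hu a
      obtain ⟨r2, h3, h4⟩ := hv a
      refine ⟨r1 + r2, Ideal.add_mem _ h1 h3, ?_⟩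
      rw [map_add, h2, h4, mul_add a, add_pow_expChar_pow, mul_add]
    · intro b u _ hu a
      obtain ⟨r, h1, h2⟩ := hu (a * b)
      refine ⟨r, h1, ?_⟩
      rw [h2, smul_eq_mul, mul_assoc]
  obtain ⟨r, h1, h2⟩ := key 1
  exact ⟨r, h1, by rwa [one_mul] at h2⟩

/-- **Theorem (Statement 2).** Let `(R, I)` be a standard graded pair over a perfect field
`k` of characteristic `p > 0`, with `R` a two-dimensional domain and graded maximal ideal
`𝔪`, and let `S` be the normalization of `R` (the integral closure of `R` in its fraction
field).  Then the `F`-thresholds `c^I(𝔪)` and `c^{IS}(𝔪S)` both exist and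
`c^I(𝔪) = c^{IS}(𝔪S)`. -/
theorem fThreshold_eq_fThreshold_normalization
    (p : ℕ) (hp : p.Prime)
    (k : Type*) [Field k] [CharP k p] [ExpChar k p] [PerfectRing k p]
    (R : Type*) [CommRing R] [IsDomain R] [Algebra k R]
    (𝒜 : ℕ → Submodule k R) [GradedAlgebra 𝒜]
    (h0 : 𝒜 0 = Submodule.span k {1})
    (hstd : ∀ n, 𝒜 (n + 1) = 𝒜 1 * 𝒜 n)
    (hfg : FiniteDimensional k (𝒜 1))
    (hdim : ringKrullDim R = 2)
    (I : Ideal R) (hIhom : Ideal.IsHomogeneous 𝒜 I)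
    (hcolen : FiniteDimensional k (R ⧸ I)) :
    ∃ c : ℝ,
      Tendsto (fun n : ℕ => (nuF (irrelevantIdeal 𝒜) I (p ^ n) : ℝ) / (p : ℝ) ^ n)
        atTop (𝓝 c) ∧
      Tendsto (fun n : ℕ =>
          (nuF
            (Ideal.map (algebraMap R ↥(integralClosure R (FractionRing R)))
              (irrelevantIdeal 𝒜))
            (Ideal.map (algebraMap R ↥(integralClosure R (FractionRing R))) I)
            (p ^ n) : ℝ) / (p : ℝ) ^ n)
        atTop (𝓝 c) := by
  have : Algebra.FiniteType k R := finiteType_of_std 𝒜 h0 hstd hfg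
  have : IsNoetherianRing R := Algebra.FiniteType.isNoetherianRing k R
  have : ExpChar R p := expChar_of_injective_algebraMap (algebraMap k R).injective p
  have hinj : Function.Injective (algebraMap R (integralClosure R (FractionRing R))) := by
    intro a b hab
    apply IsFractionRing.injective R (FractionRing R)
    exact congrArg Subtype.val hab
  have : ExpChar (integralClosure R (FractionRing R)) p := expChar_of_injective_algebraMap hinj p
  set S := integralClosure R (FractionRing R) with hS
  obtain ⟨E, hE⟩ := exists_irr_pow_le 𝒜 hstd I hIhom hcolen
  obtain ⟨μ, hμ⟩ := pow_le_frobPow p hp.pos (irrelevantIdeal 𝒜) (IsNoetherian.noetherian _)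
  obtain ⟨N, x, hx0, hx⟩ := exists_conductor k R p
  obtain ⟨C, n1, hL4⟩ := L4 𝒜 h0 hstd hdim p hp.two_le I hIhom E hE hx0
  have ha : ∀ n, irrelevantIdeal 𝒜 ^ (nuF (irrelevantIdeal 𝒜) I (p ^ n) + 1) ≤
      I.frobPow (p ^ n) := by
    intro n
    have hne : {r : ℕ | irrelevantIdeal 𝒜 ^ (r + 1) ≤ I.frobPow (p ^ n)}.Nonempty :=
      ⟨p ^ n * (E + μ), (Ideal.pow_le_pow_right (Nat.le_succ _)).trans
        ((hμ n E).trans (frobPow_mono hE _))⟩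
    exact Nat.sInf_mem hne
  have ha' : ∀ n r, irrelevantIdeal 𝒜 ^ r ≤ I.frobPow (p ^ n) →
      nuF (irrelevantIdeal 𝒜) I (p ^ n) ≤ r := fun n r h =>
    Nat.sInf_le (show irrelevantIdeal 𝒜 ^ (r + 1) ≤ _ from
      (Ideal.pow_le_pow_right (Nat.le_succ _)).trans h)
  have hmem : ∀ n, (irrelevantIdeal 𝒜).map (algebraMap R S) ^
      (nuF (irrelevantIdeal 𝒜) I (p ^ n) + 1) ≤ (I.map (algebraMap R S)).frobPow (p ^ n) := by
    intro n
    rw [map_frobPow, ← Ideal.map_pow]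
    exact Ideal.map_mono (ha n)
  have hb : ∀ n, (irrelevantIdeal 𝒜).map (algebraMap R S) ^
      (nuF ((irrelevantIdeal 𝒜).map (algebraMap R S)) (I.map (algebraMap R S)) (p ^ n) + 1) ≤
      (I.map (algebraMap R S)).frobPow (p ^ n) := by
    intro n
    have hne : {r : ℕ | (irrelevantIdeal 𝒜).map (algebraMap R S) ^ (r + 1) ≤
      (I.map (algebraMap R S)).frobPow (p ^ n)}.Nonempty := ⟨_, hmem n⟩
    exact Nat.sInf_mem hne
  refine limit_aux p hp.two_le _ _ (1 + μ + C) N n1 (fun n => Nat.sInf_le (hmem n)) ?_ ?_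
  · intro n m
    have h1 : irrelevantIdeal 𝒜 ^ (p ^ m * (nuF (irrelevantIdeal 𝒜) I (p ^ n) + 1 + μ)) ≤
        I.frobPow (p ^ (n + m)) := by
      rw [← frobPow_frobPow]
      exact (hμ m _).trans (frobPow_mono (ha n) _)
    refine (ha' _ _ h1).trans (Nat.mul_le_mul_left _ ?_)
    omega
  · intro n hn
    set b := nuF ((irrelevantIdeal 𝒜).map (algebraMap R S)) (I.map (algebraMap R S)) (p ^ n)
      with hbdef
    have h1 : ∀ g ∈ irrelevantIdeal 𝒜 ^ (p ^ N * (b + 1 + μ)),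
        x * g ∈ I.frobPow (p ^ (n + N)) := by
      have h2 : (irrelevantIdeal 𝒜 ^ (b + 1)).frobPow (p ^ N) ≤
          Submodule.comap (LinearMap.mulLeft R x) (I.frobPow (p ^ (n + N))) := by
        rw [Ideal.frobPow, Ideal.span_le]
        rintro _ ⟨f, hf, rfl⟩
        change x * f ^ (p ^ N) ∈ I.frobPow (p ^ (n + N))
        have h3 : algebraMap R S f ∈ (I.frobPow (p ^ n)).map (algebraMap R S) := by
          rw [← map_frobPow]
          apply hb n
          rw [← Ideal.map_pow]
          exact Ideal.mem_map_of_mem _ hf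
        obtain ⟨r, hr, hr2⟩ := conductor_step p N x hx _ h3
        rw [frobPow_frobPow] at hr
        have h4 : r = x * f ^ (p ^ N) := by
          apply hinj
          rw [hr2, map_mul, map_pow]
        rwa [← h4]
      exact fun g hg => h2 (hμ N _ hg)
    have h5 := ha' _ _ (hL4 (n + N) (by omega) _ h1)
    refine h5.trans ?_
    have h6 : C ≤ p ^ N * C := Nat.le_mul_of_pos_left _ (pow_pos hp.pos N)
    calc p ^ N * (b + 1 + μ) + C ≤ p ^ N * (b + 1 + μ) + p ^ N * C := by omega
      _ = p ^ N * (b + (1 + μ + C)) := by ring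
end

section
/- Let k be an algebraically closed field of characteristic p > 0, let d ≥ 4 be an integer with p not dividing d, let R = k[x, y, z]/(x^d + y^d + z^d) with its standard grading (deg x = deg y = deg z = 1) and graded maximal ideal 𝔪 = (x, y, z), and let I = (x², y², z⁵). Then α(R, I) = 4; equivalently, the F-threshold c^I(𝔪) equals 4. -/
/-!
STATEMENT 10: For `k` algebraically closed of characteristic `p > 0`, `d ≥ 4` with `p ∤ d`,
`R = k[x,y,z]/(x^d + y^d + z^d)` with the standard grading, `𝔪 = (x, y, z)` and
`I = (x², y², z⁵)`, one has `α(R, I) = 4`; equivalently `c^I(𝔪) = 4`.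
-/

open Filter Topology

/-- The defining ideal `(x^d + y^d + z^d)` of the Fermat curve of degree `d`. -/
noncomputable def fermatRel (k : Type*) [CommRing k] (d : ℕ) :
    Ideal (MvPolynomial (Fin 3) k) :=
  Ideal.span {MvPolynomial.X 0 ^ d + MvPolynomial.X 1 ^ d + MvPolynomial.X 2 ^ d}

/-- The homogeneous coordinate ring `R = k[x,y,z]/(x^d + y^d + z^d)`. -/
noncomputable abbrev FermatRing (k : Type*) [CommRing k] (d : ℕ) : Type _ :=
  MvPolynomial (Fin 3) k ⧸ fermatRel k d

/-- The standard grading on `k[x,y,z]/(x^d + y^d + z^d)`: the degree-`m` piece is the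
image of the space of homogeneous polynomials of degree `m`. -/
noncomputable def fermatGrading (k : Type*) [CommRing k] (d : ℕ) (m : ℕ) :
    Submodule k (FermatRing k d) :=
  Submodule.map (Ideal.Quotient.mkₐ k (fermatRel k d)).toLinearMap
    (MvPolynomial.homogeneousSubmodule (Fin 3) k m)

/-- The ideal `I = (x², y², z⁵)` of `k[x,y,z]/(x^d + y^d + z^d)`. -/
noncomputable def fermatI (k : Type*) [CommRing k] (d : ℕ) : Ideal (FermatRing k d) :=
  Ideal.span {Ideal.Quotient.mk (fermatRel k d) (MvPolynomial.X 0 ^ 2),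
    Ideal.Quotient.mk (fermatRel k d) (MvPolynomial.X 1 ^ 2),
    Ideal.Quotient.mk (fermatRel k d) (MvPolynomial.X 2 ^ 5)}

/-- The graded maximal ideal `𝔪 = (x, y, z)` of `k[x,y,z]/(x^d + y^d + z^d)`. -/
noncomputable def fermatM (k : Type*) [CommRing k] (d : ℕ) : Ideal (FermatRing k d) :=
  Ideal.span {Ideal.Quotient.mk (fermatRel k d) (MvPolynomial.X 0),
    Ideal.Quotient.mk (fermatRel k d) (MvPolynomial.X 1),
    Ideal.Quotient.mk (fermatRel k d) (MvPolynomial.X 2)}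

open MvPolynomial in
theorem mon_mem (k : Type*) [Field k] (d : ℕ) (hd : 1 ≤ d) (q : ℕ) (J : Ideal (FermatRing k d))
    (hx : (Ideal.Quotient.mk (fermatRel k d) (X 0)) ^ (2*q) ∈ J)
    (hy : (Ideal.Quotient.mk (fermatRel k d) (X 1)) ^ (2*q) ∈ J) (c : ℕ) :
    ∀ a b : ℕ, 4 * q + d ≤ a + b + c + 2 →
    (Ideal.Quotient.mk (fermatRel k d) (X 0)) ^ a * (Ideal.Quotient.mk (fermatRel k d) (X 1)) ^ b *
      (Ideal.Quotient.mk (fermatRel k d) (X 2)) ^ c ∈ J := by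
  have rel : (Ideal.Quotient.mk (fermatRel k d) (X 0)) ^ d +
     (Ideal.Quotient.mk (fermatRel k d) (X 1)) ^ d + (Ideal.Quotient.mk (fermatRel k d) (X 2)) ^ d = 0 := by
    rw [← map_pow, ← map_pow, ← map_pow, ← map_add, ← map_add]
    exact Ideal.Quotient.eq_zero_iff_mem.2 (Ideal.subset_span rfl)
  generalize (Ideal.Quotient.mk (fermatRel k d) (X 0)) = x at *
  generalize (Ideal.Quotient.mk (fermatRel k d) (X 1)) = y at *
  generalize (Ideal.Quotient.mk (fermatRel k d) (X 2)) = z at *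
  induction c using Nat.strong_induction_on with
  | _ c ih =>
    intro a b h
    by_cases ha : 2 * q ≤ a
    · obtain ⟨e, rfl⟩ := Nat.exists_eq_add_of_le ha
      have := J.mul_mem_left (x ^ e * y ^ b * z ^ c) hx
      convert this using 1; ring
    by_cases hb : 2 * q ≤ b
    · obtain ⟨e, rfl⟩ := Nat.exists_eq_add_of_le hb
      have := J.mul_mem_left (x ^ a * y ^ e * z ^ c) hy
      convert this using 1; ring
    have hc : d ≤ c := by omega
    obtain ⟨e, rfl⟩ := Nat.exists_eq_add_of_le hc
    have h1 := ih e (by omega) (a + d) b (by omega)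
    have h2 := ih e (by omega) a (b + d) (by omega)
    have := J.neg_mem (J.add_mem h1 h2)
    convert this using 1
    linear_combination x ^ a * y ^ b * z ^ e * rel

open MvPolynomial in
theorem monomial_mem (k : Type*) [Field k] (d : ℕ) (hd : 1 ≤ d) (q : ℕ) (J : Ideal (FermatRing k d))
    (hx : (Ideal.Quotient.mk (fermatRel k d) (X 0)) ^ (2*q) ∈ J)
    (hy : (Ideal.Quotient.mk (fermatRel k d) (X 1)) ^ (2*q) ∈ J) (s : Fin 3 →₀ ℕ)
    (hs : 4 * q + d ≤ s.degree + 2) (c : k) :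
    Ideal.Quotient.mk (fermatRel k d) (monomial s c) ∈ J := by
  rw [monomial_eq, map_mul, Finsupp.prod_fintype _ _ (by simp), Fin.prod_univ_three]
  apply J.mul_mem_left
  simp only [map_mul, map_pow]
  apply mon_mem k d hd q J hx hy
  simpa [Finsupp.degree_eq_sum, Fin.sum_univ_three] using hs

open MvPolynomial in
theorem poly_mem (k : Type*) [Field k] (d : ℕ) (hd : 1 ≤ d) (q : ℕ) (J : Ideal (FermatRing k d))
    (hx : (Ideal.Quotient.mk (fermatRel k d) (X 0)) ^ (2*q) ∈ J)
    (hy : (Ideal.Quotient.mk (fermatRel k d) (X 1)) ^ (2*q) ∈ J) (f : MvPolynomial (Fin 3) k)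
    (hs : ∀ s ∈ f.support, 4 * q + d ≤ s.degree + 2) :
    Ideal.Quotient.mk (fermatRel k d) f ∈ J := by
  rw [f.as_sum, map_sum]
  exact J.sum_mem fun s h => monomial_mem k d hd q J hx hy s (hs s h) _

open MvPolynomial in
theorem M_pow_le (k : Type*) [Field k] (d : ℕ) (hd : 1 ≤ d) (q : ℕ) (J : Ideal (FermatRing k d))
    (hx : (Ideal.Quotient.mk (fermatRel k d) (X 0)) ^ (2*q) ∈ J)
    (hy : (Ideal.Quotient.mk (fermatRel k d) (X 1)) ^ (2*q) ∈ J) (N : ℕ)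
    (hN : 4 * q + d ≤ N + 2) : fermatM k d ^ N ≤ J := by
  have : fermatM k d = (idealOfVars (Fin 3) k).map (Ideal.Quotient.mk (fermatRel k d)) := by
    rw [idealOfVars, Ideal.map_span, fermatM]
    congr 1
    ext t
    simp [Fin.exists_fin_succ, eq_comm]
  rw [this, ← Ideal.map_pow, Ideal.map_le_iff_le_comap]
  intro f hf
  rw [mem_pow_idealOfVars_iff] at hf
  apply poly_mem k d hd q J hx hy
  intro s h
  have := hf s h
  omega

theorem exists_psi (k : Type*) [Field k] (d : ℕ) (hd : 1 ≤ d) :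
    ∃ ψ : FermatRing k d →ₗ[k] Polynomial (Polynomial k),
      (∀ r, ψ (Ideal.Quotient.mk (fermatRel k d) (MvPolynomial.X 0) * r) = Polynomial.C Polynomial.X * ψ r) ∧
      (∀ r, ψ (Ideal.Quotient.mk (fermatRel k d) (MvPolynomial.X 1) * r) = Polynomial.X * ψ r) ∧
      ψ 1 = 1 := by
  set A := Polynomial (Polynomial k)
  let u : A := Polynomial.C Polynomial.X
  let v : A := Polynomial.X
  let g : Polynomial A := Polynomial.X ^ d + Polynomial.C (u ^ d + v ^ d)
  have hg : g.Monic := Polynomial.monic_X_pow_add_C _ (by omega)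
  have hdeg : g.degree = d := Polynomial.degree_X_pow_add_C (by omega) _
  let φ0 : MvPolynomial (Fin 3) k →ₐ[k] AdjoinRoot g :=
    MvPolynomial.aeval ![algebraMap A _ u, algebraMap A _ v, AdjoinRoot.root g]
  have hroot : (AdjoinRoot.root g) ^ d + algebraMap A (AdjoinRoot g) (u ^ d + v ^ d) = 0 := by
    have := AdjoinRoot.eval₂_root g
    rwa [Polynomial.eval₂_add, Polynomial.eval₂_X_pow, Polynomial.eval₂_C] at this
  let φ : FermatRing k d →ₐ[k] AdjoinRoot g := Ideal.Quotient.liftₐ _ φ0 (by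
    intro a ha
    have : fermatRel k d ≤ RingHom.ker φ0.toRingHom := by
      rw [fermatRel, Ideal.span_le, Set.singleton_subset_iff]
      simp only [SetLike.mem_coe, RingHom.mem_ker]
      rw [← hroot]
      simp [φ0]
      ring
    exact this ha)
  have hφ0 : φ (Ideal.Quotient.mk (fermatRel k d) (MvPolynomial.X 0)) = algebraMap A _ u := by
    change φ0 _ = _
    simp [φ0]
  have hφ1 : φ (Ideal.Quotient.mk (fermatRel k d) (MvPolynomial.X 1)) = algebraMap A _ v := by
    change φ0 _ = _
    simp [φ0]
  let L : AdjoinRoot g →ₗ[A] A := (Polynomial.lcoeff A 0) ∘ₗ AdjoinRoot.modByMonicHom hg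
  refine ⟨(L.restrictScalars k) ∘ₗ φ.toLinearMap, ?_, ?_, ?_⟩
  · intro r
    change L (φ _) = u * L (φ r)
    rw [map_mul, hφ0, ← Algebra.smul_def, map_smul, smul_eq_mul]
  · intro r
    change L (φ _) = v * L (φ r)
    rw [map_mul, hφ1, ← Algebra.smul_def, map_smul, smul_eq_mul]
  · change L (φ 1) = 1
    rw [map_one]
    change Polynomial.lcoeff A 0 (AdjoinRoot.modByMonicHom hg 1) = 1
    rw [← map_one (AdjoinRoot.mk g), AdjoinRoot.modByMonicHom_mk,
      (Polynomial.modByMonic_eq_self_iff hg).2]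
    · simp
    · rw [hdeg, Polynomial.degree_one]; exact_mod_cast hd

theorem mul_pow_mem {R : Type*} [CommRing R] (M : Ideal R) {x y : R} (hx : x ∈ M) (hy : y ∈ M)
    (a b : ℕ) : x ^ a * y ^ b ∈ M ^ (a + b) := by
  rw [pow_add]
  exact Ideal.mul_mem_mul (Ideal.pow_mem_pow hx _) (Ideal.pow_mem_pow hy _)

/-- The ideal `(x^{2q}, y^{2q})`. -/
noncomputable def xyIdeal (k : Type*) [Field k] (d q : ℕ) : Ideal (FermatRing k d) :=
  Ideal.span {(Ideal.Quotient.mk (fermatRel k d) (MvPolynomial.X 0)) ^ (2*q),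
    (Ideal.Quotient.mk (fermatRel k d) (MvPolynomial.X 1)) ^ (2*q)}

theorem xyIdeal_le_frobPow (k : Type*) [Field k] (d q : ℕ) :
    xyIdeal k d q ≤ (fermatI k d).frobPow q := by
  rw [xyIdeal, Ideal.span_le]
  rintro r (rfl | rfl)
  · refine Ideal.subset_span ⟨_, Ideal.subset_span (Or.inl rfl), ?_⟩
    simp [pow_mul]
  · refine Ideal.subset_span ⟨_, Ideal.subset_span (Or.inr (Or.inl rfl)), ?_⟩
    simp [pow_mul]

theorem frobPow_le (p : ℕ) (hp : p.Prime) (k : Type*) [Field k] [CharP k p] (d : ℕ) (hd : 1 ≤ d)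
    (n : ℕ) (h : d ≤ p ^ n) :
    (fermatI k d).frobPow (p ^ n) ≤ xyIdeal k d (p ^ n) := by
  set J := xyIdeal k d (p ^ n) with hJ
  have hx : (Ideal.Quotient.mk (fermatRel k d) (MvPolynomial.X 0)) ^ (2*p^n) ∈ J :=
    Ideal.subset_span (Or.inl rfl)
  have hy : (Ideal.Quotient.mk (fermatRel k d) (MvPolynomial.X 1)) ^ (2*p^n) ∈ J :=
    Ideal.subset_span (Or.inr rfl)
  have hp0 : (p : FermatRing k d) = 0 := by
    rw [← map_natCast (algebraMap k (FermatRing k d)), CharP.cast_eq_zero, map_zero]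
  rw [Ideal.frobPow, Ideal.span_le]
  rintro _ ⟨f, hf, rfl⟩
  change f ^ p ^ n ∈ J
  have hf' : f ∈ fermatI k d := hf
  rw [fermatI] at hf'
  induction hf' using Submodule.span_induction with
  | mem r hr =>
    rcases hr with rfl | rfl | rfl
    · simpa [pow_mul] using hx
    · simpa [pow_mul] using hy
    · have := mon_mem k d hd (p ^ n) J hx hy (5 * p ^ n) 0 0 (by omega)
      simpa [pow_mul] using this
  | zero => rw [zero_pow (pow_pos hp.pos n).ne']; exact J.zero_mem
  | add a b ha hb iha ihb =>
    obtain ⟨r, hr⟩ := exists_add_pow_prime_pow_eq hp a b n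
    rw [hr, hp0]
    simpa using J.add_mem (iha ha) (ihb hb)
  | smul a b hb ih =>
    rw [smul_eq_mul, mul_pow]
    exact J.mul_mem_left _ (ih hb)

theorem psi_pow {k : Type*} [Field k] {d : ℕ} {ψ : FermatRing k d →ₗ[k] Polynomial (Polynomial k)}
    {t : FermatRing k d} {T : Polynomial (Polynomial k)} (h : ∀ r, ψ (t * r) = T * ψ r) (n : ℕ)
    (r : FermatRing k d) : ψ (t ^ n * r) = T ^ n * ψ r := by
  induction n with
  | zero => simp
  | succ n ih => rw [pow_succ', mul_assoc, h, ih, pow_succ', mul_assoc]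

theorem psi_coeff {k : Type*} [Field k] {d : ℕ} {ψ : FermatRing k d →ₗ[k] Polynomial (Polynomial k)}
    (h0 : ∀ r, ψ (Ideal.Quotient.mk (fermatRel k d) (MvPolynomial.X 0) * r) =
      Polynomial.C Polynomial.X * ψ r)
    (h1 : ∀ r, ψ (Ideal.Quotient.mk (fermatRel k d) (MvPolynomial.X 1) * r) = Polynomial.X * ψ r)
    (q a b : ℕ) (ha : a < 2 * q) (hb : b < 2 * q) (r : FermatRing k d) (hr : r ∈ xyIdeal k d q) :
    ((ψ r).coeff b).coeff a = 0 := by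
  rw [xyIdeal, Ideal.mem_span_pair] at hr
  obtain ⟨u, v, rfl⟩ := hr
  rw [mul_comm u, mul_comm v, map_add, psi_pow h0, psi_pow h1, ← map_pow, Polynomial.coeff_add,
    Polynomial.coeff_C_mul, Polynomial.coeff_X_pow_mul', if_neg (by omega), add_zero,
    Polynomial.coeff_X_pow_mul', if_neg (by omega)]

theorem psi_mon {k : Type*} [Field k] {d : ℕ} {ψ : FermatRing k d →ₗ[k] Polynomial (Polynomial k)}
    (h0 : ∀ r, ψ (Ideal.Quotient.mk (fermatRel k d) (MvPolynomial.X 0) * r) =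
      Polynomial.C Polynomial.X * ψ r)
    (h1 : ∀ r, ψ (Ideal.Quotient.mk (fermatRel k d) (MvPolynomial.X 1) * r) = Polynomial.X * ψ r)
    (h2 : ψ 1 = 1) (a b a' b' : ℕ) :
    ((ψ (Ideal.Quotient.mk (fermatRel k d) (MvPolynomial.X 0) ^ a *
      Ideal.Quotient.mk (fermatRel k d) (MvPolynomial.X 1) ^ b)).coeff b').coeff a' =
      if a' = a ∧ b' = b then 1 else 0 := by
  have : ψ (Ideal.Quotient.mk (fermatRel k d) (MvPolynomial.X 0) ^ a *
      Ideal.Quotient.mk (fermatRel k d) (MvPolynomial.X 1) ^ b) =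
      Polynomial.C (Polynomial.X ^ a) * Polynomial.X ^ b := by
    rw [psi_pow h0, ← mul_one (Ideal.Quotient.mk (fermatRel k d) (MvPolynomial.X 1) ^ b),
      psi_pow h1, h2, map_pow, mul_one]
  rw [this, Polynomial.coeff_C_mul, Polynomial.coeff_X_pow]
  by_cases hb : b' = b
  · simp [hb, Polynomial.coeff_X_pow]
  · simp [hb]

theorem dim_eq_zero (k : Type*) [Field k] (d : ℕ) (hd : 1 ≤ d) (q m : ℕ) (h : 4 * q + d ≤ m + 2) :
    gradedPieceDim (fermatGrading k d) ((fermatI k d).frobPow q) m = 0 := by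
  have key : Submodule.comap (fermatGrading k d m).subtype
      (((fermatI k d).frobPow q).restrictScalars k) = ⊤ := by
    rw [eq_top_iff]
    rintro ⟨r, hr⟩ -
    obtain ⟨f, hf, rfl⟩ := hr
    change Ideal.Quotient.mk (fermatRel k d) f ∈ (fermatI k d).frobPow q
    apply xyIdeal_le_frobPow
    refine poly_mem k d hd q _ (Ideal.subset_span (Or.inl rfl)) (Ideal.subset_span (Or.inr rfl)) f ?_
    intro s hs
    have h1 : s.degree = m := by
      have hf' : f.IsHomogeneous m := hf
      rw [Finsupp.degree_eq_weight_one]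
      exact hf' (MvPolynomial.mem_support_iff.1 hs)
    omega
  rw [gradedPieceDim, key]
  have : Subsingleton ((fermatGrading k d m) ⧸ (⊤ : Submodule k (fermatGrading k d m))) :=
    Submodule.Quotient.subsingleton_iff.2 rfl
  exact Module.finrank_zero_of_subsingleton

theorem le_dim (p : ℕ) (hp : p.Prime) (k : Type*) [Field k] [CharP k p] (d : ℕ) (hd : 1 ≤ d)
    (n : ℕ) (h : d ≤ p ^ n) (m : ℕ) (hm : 2 * p ^ n ≤ m) :
    4 * p ^ n - 1 - m ≤
      gradedPieceDim (fermatGrading k d) ((fermatI k d).frobPow (p ^ n)) m := by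
  obtain ⟨ψ, h0, h1, h2⟩ := exists_psi k d hd
  set q := p ^ n with hq
  set N := 4 * q - 1 - m with hN
  let L : FermatRing k d →ₗ[k] (Fin N → k) :=
    { toFun := fun r i => ((ψ r).coeff (2 * q - 1 - i)).coeff (m + 1 - 2 * q + i)
      map_add' := fun r s => by ext i; simp
      map_smul' := fun c r => by ext i; simp }
  have : Module.Finite k (fermatGrading k d m) :=
    Module.Finite.iff_fg.2 ((MvPolynomial.homogeneousSubmodule_fg (Fin 3) k m).map _)
  rw [gradedPieceDim]
  set S := Submodule.comap (fermatGrading k d m).subtype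
      (((fermatI k d).frobPow q).restrictScalars k) with hS
  have hle : S ≤ LinearMap.ker (L ∘ₗ (fermatGrading k d m).subtype) := by
    intro r hr
    have hr' : (r : FermatRing k d) ∈ xyIdeal k d q := frobPow_le p hp k d hd n h hr
    rw [LinearMap.mem_ker]
    ext i
    exact psi_coeff h0 h1 q _ _ (by omega) (by omega) _ hr'
  have hsurj : Function.Surjective (S.liftQ _ hle) := by
    rw [← LinearMap.range_eq_top, Submodule.range_liftQ, eq_top_iff, ← (Pi.basisFun k (Fin N)).span_eq,
      Submodule.span_le]
    rintro _ ⟨i, rfl⟩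
    refine ⟨⟨Ideal.Quotient.mk (fermatRel k d) (MvPolynomial.X 0) ^ (m + 1 - 2 * q + i) *
      Ideal.Quotient.mk (fermatRel k d) (MvPolynomial.X 1) ^ (2 * q - 1 - i),
      MvPolynomial.X 0 ^ (m + 1 - 2 * q + i) * MvPolynomial.X 1 ^ (2 * q - 1 - i), ?_, ?_⟩, ?_⟩
    · have := (MvPolynomial.isHomogeneous_X_pow (R := k) (0 : Fin 3) (m + 1 - 2 * q + i)).mul
        (MvPolynomial.isHomogeneous_X_pow (R := k) (1 : Fin 3) (2 * q - 1 - i))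
      rwa [show m + 1 - 2 * q + i + (2 * q - 1 - i) = m by omega] at this
    · simp
    · ext j
      change ((ψ _).coeff _).coeff _ = _
      refine (psi_mon h0 h1 h2 _ _ _ _).trans ?_
      rw [Pi.basisFun_apply, Pi.single_apply]
      congr 1
      rw [eq_iff_iff, Fin.ext_iff]
      omega
  simpa using LinearMap.finrank_le_finrank_of_surjective hsurj

theorem nuF_bounds (p : ℕ) (hp : p.Prime) (k : Type*) [Field k] [CharP k p] (d : ℕ) (hd : 4 ≤ d)
    (n : ℕ) (h : d ≤ p ^ n) :
    4 * p ^ n ≤ nuF (fermatM k d) (fermatI k d) (p ^ n) + 2 ∧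
    nuF (fermatM k d) (fermatI k d) (p ^ n) ≤ 4 * p ^ n + d := by
  have hmem : 4 * p ^ n + d ∈
      {r : ℕ | fermatM k d ^ (r + 1) ≤ (fermatI k d).frobPow (p ^ n)} :=
    M_pow_le k d (by omega) (p ^ n) _
      (xyIdeal_le_frobPow k d _ (Ideal.subset_span (Or.inl rfl)))
      (xyIdeal_le_frobPow k d _ (Ideal.subset_span (Or.inr rfl))) _ (by omega)
  refine ⟨?_, Nat.sInf_le hmem⟩
  have hin := Nat.sInf_mem ⟨_, hmem⟩
  change fermatM k d ^ (nuF (fermatM k d) (fermatI k d) (p ^ n) + 1) ≤ _ at hin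
  by_contra hlt
  set r := nuF (fermatM k d) (fermatI k d) (p ^ n)
  set q := p ^ n with hq
  obtain ⟨ψ, h0, h1, h2⟩ := exists_psi k d (by omega)
  have e : Ideal.Quotient.mk (fermatRel k d) (MvPolynomial.X 0) ^ (2 * q - 1) *
      Ideal.Quotient.mk (fermatRel k d) (MvPolynomial.X 1) ^ (2 * q - 1) ∈
      fermatM k d ^ (r + 1) := by
    have m0 : Ideal.Quotient.mk (fermatRel k d) (MvPolynomial.X 0) ∈ fermatM k d :=
      Ideal.subset_span (Or.inl rfl)
    have m1 : Ideal.Quotient.mk (fermatRel k d) (MvPolynomial.X 1) ∈ fermatM k d :=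
      Ideal.subset_span (Or.inr (Or.inl rfl))
    have m2 := mul_pow_mem (fermatM k d) m0 m1 (2 * q - 1) (2 * q - 1)
    exact Ideal.pow_le_pow_right (show r + 1 ≤ (2 * q - 1) + (2 * q - 1) by omega) m2
  have e2 := psi_coeff h0 h1 q (2 * q - 1) (2 * q - 1) (by omega) (by omega) _
    (frobPow_le p hp k d (by omega) n h (hin e))
  rw [psi_mon h0 h1 h2] at e2
  simp at e2

/-- **Theorem (Statement 10).** For `k` algebraically closed of characteristic `p > 0` and
`d ≥ 4` with `p ∤ d`, the pair `R = k[x,y,z]/(x^d+y^d+z^d)`, `I = (x², y², z⁵)` satisfies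
`α(R, I) = 4`; equivalently, the `F`-threshold `c^I(𝔪)` equals `4`. -/
theorem alpha_fermat_eq_four
    (p : ℕ) (hp : p.Prime)
    (k : Type*) [Field k] [IsAlgClosed k] [CharP k p]
    (d : ℕ) (hd : 4 ≤ d) (hpd : ¬ p ∣ d)
    -- `f` is the Hilbert–Kunz density function of `(R, I)`:
    (f : ℝ → ℝ)
    (hf : ∀ x : ℝ, 0 ≤ x →
      Tendsto (fun n : ℕ =>
          (gradedPieceDim (fermatGrading k d) ((fermatI k d).frobPow (p ^ n))
              ⌊x * (p : ℝ) ^ n⌋₊ : ℝ) / (p : ℝ) ^ n)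
        atTop (𝓝 (f x))) :
    sSup {x : ℝ | 0 ≤ x ∧ f x ≠ 0} = 4 ∧
      Tendsto (fun n : ℕ =>
          (nuF (fermatM k d) (fermatI k d) (p ^ n) : ℝ) / (p : ℝ) ^ n)
        atTop (𝓝 4) := by
  have hp1 : (1 : ℝ) < p := by exact_mod_cast hp.one_lt
  have hq : Tendsto (fun n : ℕ => (p : ℝ) ^ n) atTop atTop := tendsto_pow_atTop_atTop_of_one_lt hp1
  have hqpos : ∀ n : ℕ, (0 : ℝ) < (p : ℝ) ^ n := fun n => by positivity
  have hinv : ∀ c : ℝ, Tendsto (fun n : ℕ => c / (p : ℝ) ^ n) atTop (𝓝 0) := fun c =>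
    hq.const_div_atTop c
  have hbig : ∀ᶠ n : ℕ in atTop, d ≤ p ^ n := by
    filter_upwards [hq.eventually_ge_atTop (d : ℝ)] with n hn
    exact_mod_cast hn
  have hzero : ∀ x : ℝ, 4 < x → f x = 0 := by
    intro x hx
    refine tendsto_nhds_unique (hf x (by linarith)) (tendsto_const_nhds.congr' ?_)
    filter_upwards [hq.eventually_ge_atTop ((d : ℝ) / (x - 4))] with n hn
    rw [dim_eq_zero k d (by omega)]
    · simp
    · have h1 : (d : ℝ) ≤ (p : ℝ) ^ n * (x - 4) := by
        rwa [div_le_iff₀ (by linarith)] at hn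
      have h2 : 4 * p ^ n + d ≤ ⌊x * (p : ℝ) ^ n⌋₊ := by
        apply Nat.le_floor
        push_cast
        linarith
      omega
  have hpos : ∀ x : ℝ, 2 < x → x < 4 → f x ≠ 0 := by
    intro x hx hx4
    have hlow : Tendsto (fun n : ℕ => (4 - x) - 1 / (p : ℝ) ^ n) atTop (𝓝 ((4 - x) - 0)) :=
      tendsto_const_nhds.sub (hinv 1)
    have : 4 - x - 0 ≤ f x := by
      refine le_of_tendsto_of_tendsto hlow (hf x (by linarith)) ?_
      filter_upwards [hbig] with n hn
      have hm : 2 * p ^ n ≤ ⌊x * (p : ℝ) ^ n⌋₊ := by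
        apply Nat.le_floor
        push_cast
        nlinarith [hqpos n]
      have h1 := le_dim p hp k d (by omega) n hn _ hm
      have h2 : 4 * p ^ n ≤ gradedPieceDim (fermatGrading k d) ((fermatI k d).frobPow (p ^ n))
          ⌊x * (p : ℝ) ^ n⌋₊ + 1 + ⌊x * (p : ℝ) ^ n⌋₊ := by omega
      have h3 : (4 : ℝ) * p ^ n ≤ gradedPieceDim (fermatGrading k d) ((fermatI k d).frobPow (p ^ n))
          ⌊x * (p : ℝ) ^ n⌋₊ + 1 + ⌊x * (p : ℝ) ^ n⌋₊ := by exact_mod_cast h2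
      have h4 : (⌊x * (p : ℝ) ^ n⌋₊ : ℝ) ≤ x * (p : ℝ) ^ n :=
        Nat.floor_le (mul_nonneg (by linarith) (hqpos n).le)
      rw [le_div_iff₀ (hqpos n), sub_mul, div_mul_cancel₀ _ (hqpos n).ne']
      linarith
    linarith
  constructor
  · apply IsLUB.csSup_eq
    · constructor
      · rintro x ⟨_, hx⟩
        by_contra hlt
        exact hx (hzero x (not_le.1 hlt))
      · intro b hb
        by_contra hlt
        have hlt := not_le.1 hlt
        have h3 : (3 : ℝ) ≤ b := hb ⟨by norm_num, hpos 3 (by norm_num) (by norm_num)⟩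
        have := hb ⟨by linarith, hpos ((b + 4) / 2) (by linarith) (by linarith)⟩
        linarith
    · exact ⟨3, by norm_num, hpos 3 (by norm_num) (by norm_num)⟩
  · have hl : Tendsto (fun n : ℕ => 4 - 2 / (p : ℝ) ^ n) atTop (𝓝 4) := by
      simpa using (tendsto_const_nhds (x := (4 : ℝ))).sub (hinv 2)
    have hu : Tendsto (fun n : ℕ => 4 + d / (p : ℝ) ^ n) atTop (𝓝 4) := by
      simpa using (tendsto_const_nhds (x := (4 : ℝ))).add (hinv d)
    refine tendsto_of_tendsto_of_tendsto_of_le_of_le' hl hu ?_ ?_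
    · filter_upwards [hbig] with n hn
      have h1 : (4 : ℝ) * p ^ n ≤ nuF (fermatM k d) (fermatI k d) (p ^ n) + 2 := by
        exact_mod_cast (nuF_bounds p hp k d hd n hn).1
      rw [le_div_iff₀ (hqpos n), sub_mul, div_mul_cancel₀ _ (hqpos n).ne']
      linarith
    · filter_upwards [hbig] with n hn
      have h1 : (nuF (fermatM k d) (fermatI k d) (p ^ n) : ℝ) ≤ 4 * p ^ n + d := by
        exact_mod_cast (nuF_bounds p hp k d hd n hn).2
      rw [div_le_iff₀ (hqpos n), add_mul, div_mul_cancel₀ _ (hqpos n).ne']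
      linarith
end
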